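/- Let q be a power of a prime and F_q the finite field with q elements. Let A, B ⊆ F_q \ {0} with |A|, |B| ≥ 2 and suppose 0 ∉ A + B. Suppose there is a constant C > 0 such that for every proper subfield G of F_q and all elements c, d ∈ F_q one has |(A + B)^{-1} ∩ (cG + d)| ≤ C·max{|G|^{1/2}, |A + B|^{51/52}}. Then there is a constant C' > 0 depending only on C such that E_+(1/A, 1/B) ≤ C'·(|A + B|^{173/104} + q^{-1/285}|A + B|^{476/285})·|B|^{4/3}. -/

import Mathlib

open scoped Classical Pointwise

noncomputable section

namespace STP

variable {F : Type} [Field F]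

def collinearTriples (A B : Finset F) : ℕ :=
  (((A ×ˢ A ×ˢ A) ×ˢ (B ×ˢ B ×ˢ B)).filter fun x =>
    (x.1.2.1 - x.1.1) * (x.2.2.2 - x.2.1) = (x.1.2.2 - x.1.1) * (x.2.2.1 - x.2.1)).card

def IsLine (l : Set (F × F)) : Prop :=
  ∃ a b c : F, (a, b) ≠ (0, 0) ∧ l = {p : F × F | a * p.1 + b * p.2 = c}

def incidences (P : Finset (F × F)) (L : Finset (Set (F × F))) : ℕ :=
  ((P ×ˢ L).filter fun x => x.1 ∈ x.2).card

def kIncidences (P : Finset (F × F)) (L : Finset (Set (F × F))) (k : ℕ) : ℕ :=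
  (((Fintype.piFinset fun _ : Fin k => P) ×ˢ L).filter fun x => ∀ i, x.1 i ∈ x.2).card

def numLines (P : Finset (F × F)) : ℕ :=
  Set.ncard {l : Set (F × F) | IsLine l ∧ 2 ≤ (P.filter (· ∈ l)).card}

def addEnergy (X Y : Finset F) : ℕ :=
  (((X ×ˢ X) ×ˢ (Y ×ˢ Y)).filter fun t => t.1.1 + t.2.1 = t.1.2 + t.2.2).card

def mulEnergy (A : Finset F) : ℕ :=
  (((A ×ˢ A) ×ˢ (A ×ˢ A)).filter fun t => t.1.1 * t.2.1 = t.1.2 * t.2.2).card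

def quotSet (X : Finset F) : Set F :=
  {r : F | ∃ x1 ∈ X, ∃ x2 ∈ X, ∃ x3 ∈ X, ∃ x4 ∈ X, x3 ≠ x4 ∧ r = (x1 - x2) / (x3 - x4)}

def subfieldCond (A : Finset F) (C bound : ℝ) : Prop :=
  ∀ G : Subfield F, G ≠ ⊤ → ∀ c d : F,
    ((A.filter fun x => ∃ g ∈ G, x = c * g + d).card : ℝ) ≤
      C * max ((Nat.card G : ℝ) ^ ((1:ℝ)/2)) bound

def linesOf [Fintype F] (P : Finset (F × F)) : Finset (Set (F × F)) :=
  Set.Finite.toFinset (Set.toFinite {l : Set (F × F) | IsLine l ∧ 2 ≤ (P.filter (· ∈ l)).card})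

def tripleCount [Fintype F] (P : Finset (F × F)) : ℕ :=
  ∑ l ∈ linesOf P, ((P.filter (· ∈ l)).card) ^ 3

section counting
variable {α β : Type*}

lemma fib_lower (s : Finset α) (T : Finset β) (f : α → β) (k : ℝ)
    (h : ∀ y ∈ T, k ≤ ((s.filter fun x => f x = y).card : ℝ)) : k * T.card ≤ s.card := by
  have h1 : ∑ y ∈ T, ((s.filter fun x => f x = y).card) ≤ s.card := by
    rw [← Finset.card_biUnion]
    · apply Finset.card_le_card
      intro x hx
      simp only [Finset.mem_biUnion, Finset.mem_filter] at hx
      exact hx.choose_spec.2.1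
    · intro y _ z _ hyz
      rw [Function.onFun, Finset.disjoint_left]
      intro x hx hx2
      simp only [Finset.mem_filter] at hx hx2
      exact hyz (hx.2.symm.trans hx2.2)
  have h2 : (T.card : ℝ) * k ≤ ∑ y ∈ T, ((s.filter fun x => f x = y).card : ℝ) := by
    rw [← nsmul_eq_mul]
    exact Finset.card_nsmul_le_sum _ _ _ h
  have h3 : (∑ y ∈ T, ((s.filter fun x => f x = y).card : ℝ)) ≤ s.card := by exact_mod_cast h1
  linarith

lemma fib_upper (s : Finset α) (T : Finset β) (f : α → β) (k : ℝ) (hf : ∀ x ∈ s, f x ∈ T)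
    (h : ∀ y ∈ T, ((s.filter fun x => f x = y).card : ℝ) ≤ k) : (s.card : ℝ) ≤ k * T.card := by
  have h1 := Finset.card_eq_sum_card_fiberwise (f := f) (s := s) (t := T) hf
  rw [h1]
  push_cast
  have := Finset.sum_le_card_nsmul T _ k h
  rw [nsmul_eq_mul] at this
  linarith

lemma fib_pigeon (s : Finset α) (T : Finset β) (f : α → β) (hT : T.Nonempty)
    (hf : ∀ x ∈ s, f x ∈ T) :
    ∃ y ∈ T, (s.card : ℝ) ≤ ((s.filter fun x => f x = y).card : ℝ) * T.card := by
  by_contra! hcon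
  have h1 := Finset.card_eq_sum_card_fiberwise (f := f) (s := s) (t := T) hf
  have hpos : (0:ℝ) < T.card := by exact_mod_cast hT.card_pos
  have : ∑ y ∈ T, ((s.filter fun x => f x = y).card : ℝ) < ∑ y ∈ T, (s.card : ℝ) / T.card := by
    apply Finset.sum_lt_sum_of_nonempty hT
    intro y hy
    rw [lt_div_iff₀ hpos]
    exact hcon y hy
  rw [Finset.sum_const, nsmul_eq_mul, mul_div_cancel₀ _ hpos.ne'] at this
  rw [h1] at this
  push_cast at this
  exact lt_irrefl _ this

/-- Popularity: a sum of a function bounded by `u` on `s` is at least `σ |s|`, many large values. -/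
lemma popular (s : Finset α) (f : α → ℝ) (u θ : ℝ) (hu : ∀ x ∈ s, f x ≤ u) (hθ : 0 ≤ θ) :
    ∑ x ∈ s, f x ≤ u * ((s.filter fun x => θ ≤ f x).card : ℝ) + θ * s.card := by
  have h1 := Finset.sum_filter_add_sum_filter_not s (fun x => θ ≤ f x) f
  rw [← h1]
  have h2 : ∑ x ∈ s.filter (fun x => θ ≤ f x), f x ≤ (s.filter fun x => θ ≤ f x).card • u :=
    Finset.sum_le_card_nsmul _ _ _ (fun x hx => hu x (Finset.mem_filter.1 hx).1)
  have h3 : ∑ x ∈ s.filter (fun x => ¬ θ ≤ f x), f x ≤ (s.filter fun x => ¬ θ ≤ f x).card • θ :=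
    Finset.sum_le_card_nsmul _ _ _ (fun x hx => le_of_lt (not_le.1 (Finset.mem_filter.1 hx).2))
  rw [nsmul_eq_mul] at h2 h3
  have h4 : ((s.filter fun x => ¬ θ ≤ f x).card : ℝ) ≤ s.card := by
    exact_mod_cast Finset.card_filter_le _ _
  nlinarith

lemma op_fiber (V E : Finset F) (g : F → F → F) (k : ℝ)
    (h : ∀ x ∈ V, ∃ s w, x = g s w ∧ ∃ T : Finset F, k ≤ (T.card : ℝ) ∧
      (∀ t ∈ T, g s t ∈ E ∧ g w t ∈ E ∧ g (g s t) (g w t) = g s w) ∧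
      Set.InjOn (g s) (T : Set F)) : k * V.card ≤ (E.card : ℝ) ^ 2 := by
  have := fib_lower (E ×ˢ E) V (fun p => g p.1 p.2) k ?_
  · rw [Finset.card_product] at this
    push_cast at this
    nlinarith
  · intro x hx
    obtain ⟨s, w, rfl, T, hT, h1, h2⟩ := h x hx
    refine hT.trans ?_
    norm_cast
    apply Finset.card_le_card_of_injOn (fun t => (g s t, g w t))
    · intro t ht
      have := h1 t ht
      simp only [Finset.coe_filter, Finset.mem_product, Set.mem_setOf_eq]
      exact ⟨⟨this.1, this.2.1⟩, this.2.2⟩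
    · intro t ht t' ht' htt
      exact h2 ht ht' (Prod.ext_iff.1 htt).1

lemma class_count {γ : Type*} (A M : Finset F) (g : F → F → F) (f : F → γ)
    (hf : ∀ z ∈ A, ∀ m ∈ M, f (g z m) = f z)
    (hg : ∀ z ∈ A, Set.InjOn (g z) (M : Set F)) :
    ((A.image f).card : ℝ) * M.card ≤ (Finset.image₂ g A M).card := by
  have := fib_lower (Finset.image₂ g A M) (A.image f) f M.card ?_
  · linarith
  intro y hy
  obtain ⟨z, hz, rfl⟩ := Finset.mem_image.1 hy
  norm_cast
  apply Finset.card_le_card_of_injOn (g z)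
  · intro m hm
    simp only [Finset.coe_filter, Set.mem_setOf_eq]
    exact ⟨Finset.mem_image₂_of_mem hz hm, hf z hz m hm⟩
  · exact hg z hz

lemma cover (Y I A D : Finset F) (hIA : I ⊆ A) (hI : I.Nonempty)
    (hD : ∀ y ∈ Y, ∀ i ∈ I, y - i ∈ D) :
    ∃ Y' Z : Finset F, Y' ⊆ Y ∧ 7 * Y.card ≤ 8 * Y'.card ∧ Z.card * I.card ≤ 8 * D.card ∧
      Y' ⊆ Z + A := by
  rcases Y.eq_empty_or_nonempty with rfl | hY
  · exact ⟨∅, ∅, by simp⟩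
  have key : ∃ Y' Z : Finset F, Y' ⊆ Y ∧ 7 * Y.card ≤ 8 * Y'.card ∧
      Z.card * (Y.card * I.card) ≤ 8 * D.card * Y'.card ∧ Y' ⊆ Z + A := by
    obtain ⟨Y', hY', hmax⟩ := Finset.exists_max_image
      (Y.powerset.filter fun Y' => ∃ Z : Finset F,
        Z.card * (Y.card * I.card) ≤ 8 * D.card * Y'.card ∧ Y' ⊆ Z + A) (fun Y' => Y'.card)
      ⟨∅, by simp⟩
    simp only [Finset.mem_filter, Finset.mem_powerset] at hY' hmax
    obtain ⟨hsub, Z, hZ1, hZ2⟩ := hY'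
    refine ⟨Y', Z, hsub, ?_, hZ1, hZ2⟩
    by_contra! hlt
    set U := Y \ Y' with hU
    have hUc : U.card + Y'.card = Y.card := Finset.card_sdiff_add_card_eq_card hsub
    have hUp : Y.card < 8 * U.card := by omega
    have hUne : U.Nonempty := by
      rw [← Finset.card_pos]; omega
    obtain ⟨u0, hu0⟩ := hUne
    obtain ⟨i0, hi0⟩ := hI
    have hDne : D.Nonempty := ⟨_, hD u0 (Finset.sdiff_subset hu0) i0 hi0⟩
    obtain ⟨z, hz, hz2⟩ := fib_pigeon (U ×ˢ I) D (fun p => p.1 - p.2) hDne (by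
      intro p hp
      rw [Finset.mem_product] at hp
      exact hD _ (Finset.sdiff_subset hp.1) _ hp.2)
    set W := (U ×ˢ I).filter fun p => p.1 - p.2 = z with hW
    set U1 := W.image Prod.fst with hU1
    have hcard : U1.card = W.card := by
      apply Finset.card_image_of_injOn
      intro p hp p' hp' hpp
      simp only [hW, Finset.coe_filter, Set.mem_setOf_eq] at hp hp'
      have : p.1 = p'.1 := hpp
      refine Prod.ext this ?_
      have h1 := hp.2
      rw [← hp'.2, this] at h1
      exact sub_right_injective h1
    rw [Finset.card_product] at hz2
    have hz3 : U.card * I.card ≤ U1.card * D.card := by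
      rw [hcard]; exact_mod_cast hz2
    have hU1U : U1 ⊆ U := by
      intro x hx
      obtain ⟨p, hp, rfl⟩ := Finset.mem_image.1 hx
      exact (Finset.mem_product.1 (Finset.mem_filter.1 hp).1).1
    have hdis : Disjoint Y' U1 := by
      refine Finset.disjoint_of_subset_right hU1U ?_
      exact Finset.disjoint_sdiff
    have hI0 : 0 < I.card := Finset.card_pos.2 ⟨i0, hi0⟩
    have hU1pos : 0 < U1.card := by
      by_contra h0
      have : U1.card = 0 := by omega
      rw [this] at hz3
      have : 0 < U.card * I.card := Nat.mul_pos (Finset.card_pos.2 ⟨u0, hu0⟩) hI0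
      omega
    have hnew := hmax (Y' ∪ U1) ⟨?_, Z ∪ {z}, ?_, ?_⟩
    · rw [Finset.card_union_of_disjoint hdis] at hnew
      omega
    · exact Finset.union_subset hsub (hU1U.trans Finset.sdiff_subset)
    · rw [Finset.card_union_of_disjoint hdis]
      have h1 : (Z ∪ {z}).card ≤ Z.card + 1 := by
        refine (Finset.card_union_le _ _).trans ?_
        simp
      calc (Z ∪ {z}).card * (Y.card * I.card) ≤ (Z.card + 1) * (Y.card * I.card) :=
            Nat.mul_le_mul_right _ h1
        _ ≤ 8 * D.card * (Y'.card + U1.card) := by nlinarith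
    · intro x hx
      rcases Finset.mem_union.1 hx with hx | hx
      · obtain ⟨a, ha, b, hb, rfl⟩ := Finset.mem_add.1 (hZ2 hx)
        exact Finset.add_mem_add (Finset.mem_union_left _ ha) hb
      · obtain ⟨p, hp, rfl⟩ := Finset.mem_image.1 hx
        have hp2 := Finset.mem_filter.1 hp
        refine Finset.mem_add.2 ⟨z, by simp, p.2, hIA (Finset.mem_product.1 hp2.1).2, ?_⟩
        rw [← hp2.2]; ring
  obtain ⟨Y', Z, h1, h2, h3, h4⟩ := key
  refine ⟨Y', Z, h1, h2, ?_, h4⟩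
  have h5 : Y'.card ≤ Y.card := Finset.card_le_card h1
  have h6 : 0 < Y.card := Finset.card_pos.2 hY
  have h7 : (Z.card * I.card) * Y.card ≤ (8 * D.card) * Y.card := by nlinarith
  exact Nat.le_of_mul_le_mul_right h7 h6

end counting

lemma exists_minimiser {Γ : Type*} [AddCommGroup Γ] [DecidableEq Γ] (A B : Finset Γ) (hA : A.Nonempty) :
    ∃ X ⊆ A, X.Nonempty ∧ (∀ X' ⊆ X, (X + B).card * X'.card ≤ (X' + B).card * X.card) ∧
      (X + B).card * A.card ≤ (A + B).card * X.card := by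
  obtain ⟨X, hX, hmin⟩ := Finset.exists_min_image (A.powerset.erase ∅)
    (fun C => ((C + B).card : ℚ) / C.card) ⟨A, by simp [hA.ne_empty]⟩
  simp only [Finset.mem_erase, Finset.mem_powerset] at hX hmin
  have hXne : X.Nonempty := Finset.nonempty_iff_ne_empty.2 hX.1
  have hXp : (0:ℚ) < X.card := by exact_mod_cast hXne.card_pos
  have key : ∀ X' ⊆ A, X'.Nonempty → (X + B).card * X'.card ≤ (X' + B).card * X.card := by
    intro X' h1 h2
    have := hmin X' ⟨h2.ne_empty, h1⟩
    have hXp' : (0:ℚ) < X'.card := by exact_mod_cast h2.card_pos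
    rw [div_le_div_iff₀ hXp hXp'] at this
    exact_mod_cast this
  refine ⟨X, hX.2, hXne, ?_, key A subset_rfl hA⟩
  intro X' h1
  rcases X'.eq_empty_or_nonempty with rfl | h2
  · simp
  · exact key X' (h1.trans hX.2) h2

lemma plunnecke_two (Y B1 B2 : Finset F) (hY : Y.Nonempty) :
    ∃ X ⊆ Y, X.Nonempty ∧
      (X + B1 + B2).card * Y.card ^ 2 ≤ 4 * (Y + B1).card * (Y + B2).card * X.card := by
  rcases B1.eq_empty_or_nonempty with rfl | hB1
  · exact ⟨Y, subset_rfl, hY, by simp⟩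
  rcases B2.eq_empty_or_nonempty with rfl | hB2
  · exact ⟨Y, subset_rfl, hY, by simp⟩
  set t1 := (Y + B2).card with ht1
  set t2 := (Y + B1).card with ht2
  have ht1p : 0 < t1 := (hY.add hB2).card_pos
  have ht2p : 0 < t2 := (hY.add hB1).card_pos
  set T1 : Finset ℤ := (Finset.range t1).image (fun i : ℕ => (i : ℤ)) with hT1
  set T2 : Finset ℤ := (Finset.range t2).image (fun i : ℕ => (i : ℤ)) with hT2
  have hT1c : T1.card = t1 := by
    rw [hT1, Finset.card_image_of_injective _ Nat.cast_injective, Finset.card_range]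
  have hT2c : T2.card = t2 := by
    rw [hT2, Finset.card_image_of_injective _ Nat.cast_injective, Finset.card_range]
  set Y0 : Finset (F × ℤ × ℤ) := Y ×ˢ ({0} ×ˢ {0}) with hY0
  set P1 : Finset (F × ℤ × ℤ) := B1 ×ˢ (T1 ×ˢ {0}) with hP1
  set P2 : Finset (F × ℤ × ℤ) := B2 ×ˢ ({0} ×ˢ T2) with hP2
  have hY0ne : Y0.Nonempty := by
    obtain ⟨y, hy⟩ := hY
    exact ⟨(y, 0, 0), by simp [hY0, hy]⟩
  have hY0c : Y0.card = Y.card := by simp [hY0]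
  have hbig : (Y0 + (P1 ∪ P2)).card ≤ 2 * t1 * t2 := by
    have hsub : Y0 + (P1 ∪ P2) ⊆
        ((Y + B1) ×ˢ (T1 ×ˢ ({0} : Finset ℤ))) ∪ ((Y + B2) ×ˢ (({0} : Finset ℤ) ×ˢ T2)) := by
      intro x hx
      obtain ⟨a, ha, b, hb, rfl⟩ := Finset.mem_add.1 hx
      simp only [hY0, hP1, hP2, Finset.mem_union, Finset.mem_product, Finset.mem_singleton] at ha hb
      rcases hb with hb | hb
      · apply Finset.mem_union_left
        simp only [Finset.mem_product, Finset.mem_singleton, Prod.fst_add, Prod.snd_add]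
        refine ⟨Finset.add_mem_add ha.1 hb.1, ?_, ?_⟩
        · rw [ha.2.1, zero_add]; exact hb.2.1
        · rw [ha.2.2, zero_add]; exact hb.2.2
      · apply Finset.mem_union_right
        simp only [Finset.mem_product, Finset.mem_singleton, Prod.fst_add, Prod.snd_add]
        refine ⟨Finset.add_mem_add ha.1 hb.1, ?_, ?_⟩
        · rw [ha.2.1, zero_add]; exact hb.2.1
        · rw [ha.2.2, zero_add]; exact hb.2.2
    refine (Finset.card_le_card hsub).trans ((Finset.card_union_le _ _).trans ?_)
    simp only [Finset.card_product, Finset.card_singleton, hT1c, hT2c]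
    rw [← ht1, ← ht2]
    nlinarith
  obtain ⟨X0, hX0Y, hX0ne, hmin, hle⟩ := exists_minimiser Y0 (P1 ∪ P2) hY0ne
  have hpet := Finset.pluennecke_petridis_inequality_add (A := X0) (B := P1 ∪ P2) (P1 ∪ P2) hmin
  set X := X0.image Prod.fst with hX
  have hXc : X.card = X0.card := by
    apply Finset.card_image_of_injOn
    intro x hx x' hx' hxx
    have h1 := hX0Y hx
    have h2 := hX0Y hx'
    simp only [hY0, Finset.mem_product, Finset.mem_singleton] at h1 h2
    refine Prod.ext hxx (Prod.ext ?_ ?_)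
    · rw [h1.2.1, h2.2.1]
    · rw [h1.2.2, h2.2.2]
  have hXsub : X ⊆ Y := by
    intro x hx
    obtain ⟨x0, hx0, rfl⟩ := Finset.mem_image.1 hx
    have h1 := hX0Y hx0
    simp only [hY0, Finset.mem_product] at h1
    exact h1.1
  refine ⟨X, hXsub, hX0ne.image _, ?_⟩
  have hlow : (X + B1 + B2).card * (t1 * t2) ≤ ((P1 ∪ P2) + X0 + (P1 ∪ P2)).card := by
    have : ((X + B1 + B2) ×ˢ (T1 ×ˢ T2)).card = (X + B1 + B2).card * (t1 * t2) := by
      simp only [Finset.card_product, hT1c, hT2c]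
    rw [← this]
    apply Finset.card_le_card
    rintro ⟨x, i, j⟩ hx
    simp only [Finset.mem_product] at hx
    obtain ⟨hx, hi, hj⟩ := hx
    obtain ⟨a, ha, b2, hb2, rfl⟩ := Finset.mem_add.1 hx
    obtain ⟨x, hx3, b1, hb1, rfl⟩ := Finset.mem_add.1 ha
    obtain ⟨x0, hx0, rfl⟩ := Finset.mem_image.1 hx3
    have h1 := hX0Y hx0
    simp only [hY0, Finset.mem_product, Finset.mem_singleton] at h1
    refine Finset.mem_add.2 ⟨(b1, i, 0) + x0, Finset.add_mem_add ?_ hx0, (b2, 0, j), ?_, ?_⟩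
    · apply Finset.mem_union_left
      simp [hP1, hb1, hi]
    · apply Finset.mem_union_right
      simp [hP2, hb2, hj]
    · refine Prod.ext ?_ (Prod.ext ?_ ?_)
      · simp [add_comm, add_left_comm]
      · simp [h1.2.1]
      · simp [h1.2.2]
  rw [hXc]
  rw [add_comm (P1 ∪ P2) X0] at hpet hlow
  set u := (X0 + (P1 ∪ P2)).card with hu
  set w := (X0 + (P1 ∪ P2) + (P1 ∪ P2)).card with hw
  have hx0 : 0 < X0.card := hX0ne.card_pos
  rw [hY0c] at hle
  -- combine
  have e1 : u * Y.card ≤ 2 * t1 * t2 * X0.card := hle.trans (Nat.mul_le_mul_right _ hbig)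
  have e2 : (u * Y.card) * (u * Y.card) ≤ (2 * t1 * t2 * X0.card) * (2 * t1 * t2 * X0.card) :=
    Nat.mul_le_mul e1 e1
  have e3 : ((X + B1 + B2).card * Y.card ^ 2) * (t1 * t2 * X0.card) ≤
      (4 * t2 * t1 * X0.card) * (t1 * t2 * X0.card) := by
    calc ((X + B1 + B2).card * Y.card ^ 2) * (t1 * t2 * X0.card)
        = ((X + B1 + B2).card * (t1 * t2)) * X0.card * Y.card ^ 2 := by ring
      _ ≤ w * X0.card * Y.card ^ 2 := by gcongr
      _ ≤ u * u * Y.card ^ 2 := by gcongr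
      _ = (u * Y.card) * (u * Y.card) := by ring
      _ ≤ _ := e2
      _ = _ := by ring
  exact Nat.le_of_mul_le_mul_right e3 (by positivity)

lemma card_two_sub_two (A : Finset F) (hA : A.Nonempty) (L : ℝ)
    (h : ((A - A).card : ℝ) ≤ L * A.card) :
    ((A - A + (A - A)).card : ℝ) ≤ L ^ 4 * A.card := by
  have h1 := Finset.pluennecke_ruzsa_inequality_nsmul_sub_nsmul_sub hA A 2 2
  have h2 : (2 • A - 2 • A : Finset F) = A - A + (A - A) := by
    rw [two_nsmul, add_sub_add_comm]
  rw [h2] at h1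
  have hp : (0:ℝ) < A.card := by exact_mod_cast hA.card_pos
  have h3 : ((A - A + (A - A)).card : ℝ) ≤ (((A - A).card : ℝ) / A.card) ^ 4 * A.card := by
    have := (NNRat.cast_le (K := ℝ)).2 h1
    push_cast at this
    exact this
  refine h3.trans ?_
  have h4 : ((A - A).card : ℝ) / A.card ≤ L := by
    rw [div_le_iff₀ hp]; exact h
  gcongr

lemma drc_choose (S T : Finset F) (Γ : Finset (F × F)) (hΓ : Γ ⊆ S ×ˢ T) (hT : T.Nonempty)
    (cod : F → F → ℕ)
    (hcod : ∀ s w, cod s w = (T.filter fun t => (s, t) ∈ Γ ∧ (w, t) ∈ Γ).card)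
    (τ : ℝ) (hτ0 : 0 ≤ τ)
    (hτ : 32 * τ * T.card * (S.card : ℝ) ^ 2 ≤ (Γ.card : ℝ) ^ 2)
    (Nb : F → Finset F) (hNb : ∀ t, Nb t = S.filter fun s => (s, t) ∈ Γ) :
    ∃ t ∈ T, (Γ.card : ℝ) ^ 2 ≤ 2 * (T.card : ℝ) ^ 2 * (((Nb t).card : ℝ) ^ 2 -
      16 * (((Nb t ×ˢ Nb t).filter fun p => (cod p.1 p.2 : ℝ) < τ).card : ℝ)) := by
  by_contra! hcon
  have hTp : (0:ℝ) < T.card := by exact_mod_cast hT.card_pos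
  have h1 : (Γ.card : ℝ) = ∑ t ∈ T, ((Nb t).card : ℝ) := by
    rw [Finset.card_eq_sum_card_fiberwise (f := Prod.snd) (s := Γ) (t := T)
      (fun p hp => (Finset.mem_product.1 (hΓ hp)).2)]
    push_cast
    apply Finset.sum_congr rfl
    intro t _
    norm_cast
    symm
    apply Finset.card_bij (fun s _ => (s, t))
    · intro s hs
      rw [hNb, Finset.mem_filter] at hs
      simp [hs.2]
    · intro s _ s' _ h
      exact (Prod.ext_iff.1 h).1
    · rintro ⟨s, t'⟩ hp
      simp only [Finset.mem_filter] at hp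
      obtain ⟨hp, rfl⟩ := hp
      exact ⟨s, by rw [hNb, Finset.mem_filter]; exact ⟨(Finset.mem_product.1 (hΓ hp)).1, hp⟩, rfl⟩
  have h2 : (Γ.card : ℝ) ^ 2 ≤ T.card * ∑ t ∈ T, ((Nb t).card : ℝ) ^ 2 := by
    rw [h1]; exact sq_sum_le_card_mul_sum_sq
  have h3 : ∑ t ∈ T, (((Nb t ×ˢ Nb t).filter fun p => (cod p.1 p.2 : ℝ) < τ).card : ℝ)
      ≤ τ * (S.card : ℝ) ^ 2 := by
    have e1 : ∀ t ∈ T, (((Nb t ×ˢ Nb t).filter fun p => (cod p.1 p.2 : ℝ) < τ).card : ℝ) =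
        ∑ p ∈ S ×ˢ S, if ((p.1, t) ∈ Γ ∧ (p.2, t) ∈ Γ) ∧ (cod p.1 p.2 : ℝ) < τ then (1:ℝ) else 0 := by
      intro t _
      rw [← Finset.sum_filter, Finset.sum_const, nsmul_eq_mul, mul_one]
      norm_cast
      congr 1
      ext p
      simp only [Finset.mem_filter, Finset.mem_product, hNb]
      tauto
    rw [Finset.sum_congr rfl e1, Finset.sum_comm]
    have e2 : ∀ p ∈ S ×ˢ S, (∑ t ∈ T, if ((p.1, t) ∈ Γ ∧ (p.2, t) ∈ Γ) ∧ (cod p.1 p.2 : ℝ) < τ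
        then (1:ℝ) else 0) ≤ τ := by
      intro p _
      by_cases hb : (cod p.1 p.2 : ℝ) < τ
      · simp only [hb, and_true]
        rw [← Finset.sum_filter, Finset.sum_const, nsmul_eq_mul, mul_one, ← hcod]
        exact hb.le
      · simp only [hb, and_false, if_false, Finset.sum_const_zero]
        exact hτ0
    refine (Finset.sum_le_card_nsmul _ _ _ e2).trans ?_
    rw [nsmul_eq_mul, Finset.card_product]
    push_cast
    nlinarith
  have h4 : ∑ t ∈ T, 2 * (T.card : ℝ) ^ 2 * (((Nb t).card : ℝ) ^ 2 -
      16 * (((Nb t ×ˢ Nb t).filter fun p => (cod p.1 p.2 : ℝ) < τ).card : ℝ)) <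
      ∑ t ∈ T, (Γ.card : ℝ) ^ 2 := Finset.sum_lt_sum_of_nonempty hT hcon
  rw [← Finset.mul_sum, Finset.sum_sub_distrib, ← Finset.mul_sum, Finset.sum_const,
    nsmul_eq_mul] at h4
  set a := ∑ t ∈ T, ((Nb t).card : ℝ) ^ 2
  set b := ∑ t ∈ T, (((Nb t ×ˢ Nb t).filter fun p => (cod p.1 p.2 : ℝ) < τ).card : ℝ)
  set e := (Γ.card : ℝ)
  set m := (T.card : ℝ)
  have h5 : 2 * m * (a - 16 * b) < e ^ 2 := by
    have : m * (2 * m * (a - 16 * b)) < m * e ^ 2 := by nlinarith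
    exact lt_of_mul_lt_mul_left this hTp.le
  nlinarith

lemma op_growth (S' A E : Finset F) (hA : A ⊆ S') (good : F → F → Prop) (g : F → F → F)
    (τ n : ℝ)
    (hinj : ∀ s ∈ S', ∀ t t', t ≠ 0 → t' ≠ 0 → g s t = g s t' → t = t')
    (hgood : ∀ s ∈ S', ∀ w ∈ S', good s w → ∃ T : Finset F, τ ≤ (T.card : ℝ) ∧
      ∀ t ∈ T, t ≠ 0 ∧ g s t ∈ E ∧ g w t ∈ E ∧ g (g s t) (g w t) = g s w)
    (hAA : ∀ s ∈ A, ∀ s' ∈ A, ∃ W ⊆ S', n / 2 ≤ (W.card : ℝ) ∧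
      ∀ w ∈ W, w ≠ 0 ∧ good s w ∧ good s' w ∧ g (g s w) (g s' w) = g s s') :
    τ * (((S' ×ˢ S').filter fun p => good p.1 p.2).image fun p => g p.1 p.2).card ≤
      (E.card : ℝ) ^ 2 ∧
    (n / 2) * (Finset.image₂ g A A).card ≤
      ((((S' ×ˢ S').filter fun p => good p.1 p.2).image fun p => g p.1 p.2).card : ℝ) ^ 2 := by
  constructor
  · apply op_fiber _ _ g
    intro x hx
    obtain ⟨⟨s, w⟩, hp, rfl⟩ := Finset.mem_image.1 hx
    simp only [Finset.mem_filter, Finset.mem_product] at hp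
    obtain ⟨T, h1, h2⟩ := hgood s hp.1.1 w hp.1.2 hp.2
    refine ⟨s, w, rfl, T, h1, fun t ht => (h2 t ht).2, ?_⟩
    intro t ht t' ht' htt
    exact hinj s hp.1.1 t t' (h2 t ht).1 (h2 t' ht').1 htt
  · apply op_fiber _ _ g
    intro x hx
    obtain ⟨s, hs, s', hs', rfl⟩ := Finset.mem_image₂.1 hx
    obtain ⟨W, hW, h1, h2⟩ := hAA s hs s' hs'
    refine ⟨s, s', rfl, W, h1, fun w hw => ⟨?_, ?_, (h2 w hw).2.2.2⟩, ?_⟩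
    · exact Finset.mem_image.2 ⟨(s, w), by
        simp only [Finset.mem_filter, Finset.mem_product]
        exact ⟨⟨hA hs, hW hw⟩, (h2 w hw).2.1⟩, rfl⟩
    · exact Finset.mem_image.2 ⟨(s', w), by
        simp only [Finset.mem_filter, Finset.mem_product]
        exact ⟨⟨hA hs', hW hw⟩, (h2 w hw).2.2.1⟩, rfl⟩
    · intro t ht t' ht' htt
      exact hinj s (hA hs) t t' (h2 t ht).1 (h2 t' ht').1 htt

lemma drc_num1 (N H τ n a x y E : ℝ) (hE0 : 0 ≤ E) (hE : E ≤ N) (hx0 : 0 ≤ x) (hτp : 0 < τ)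
    (hnp : 0 < n) (hAlow : 3 / 4 * n ≤ a) (hHtau : 2 * N ^ 2 ≤ H * τ * n)
    (h1 : τ * x ≤ E ^ 2) (h2 : n / 2 * y ≤ x ^ 2) : 2 * x ≤ H * n ∧ y ≤ H ^ 2 * a := by
  have h3 : E ^ 2 ≤ N ^ 2 := by gcongr
  have h4 : 2 * x ≤ H * n := by
    have : τ * (2 * x) ≤ τ * (H * n) := by linarith
    exact le_of_mul_le_mul_left this hτp
  refine ⟨h4, ?_⟩
  have h5 : (2 * x) ^ 2 ≤ (H * n) ^ 2 := by gcongr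
  have h6 : n * (2 * y) ≤ n * (H ^ 2 * n) := by nlinarith
  have h7 := le_of_mul_le_mul_left h6 hnp
  nlinarith [sq_nonneg H]

lemma drc_num2 (N H τ n t s e : ℝ) (ht : 0 < t) (hs : 0 < s) (hep : 0 < e)
    (hτe : 32 * τ * t * s ^ 2 = e ^ 2) (hne : e ≤ 2 * t * n)
    (hH : 128 * N ^ 2 * t ^ 2 * s ^ 2 ≤ H * e ^ 3) : 2 * N ^ 2 ≤ H * τ * n := by
  have h1 : 128 * N ^ 2 * t ^ 2 * s ^ 2 ≤ H * (32 * τ * t * s ^ 2) * (2 * t * n) := by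
    rw [hτe]
    refine hH.trans ?_
    have hH0 : 0 ≤ H := by
      by_contra hneg
      have : H * e ^ 3 < 0 := mul_neg_of_neg_of_pos (not_le.1 hneg) (by positivity)
      have : 0 ≤ 128 * N ^ 2 * t ^ 2 * s ^ 2 := by positivity
      linarith
    calc H * e ^ 3 = H * e ^ 2 * e := by ring
      _ ≤ _ := by gcongr
  have h2 : (64 * t ^ 2 * s ^ 2) * (2 * N ^ 2) ≤ (64 * t ^ 2 * s ^ 2) * (H * τ * n) := by
    linarith
  exact le_of_mul_le_mul_left h2 (by positivity)

set_option maxHeartbeats 1000000 in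
lemma drc (S T D Q : Finset F) (hS0 : (0:F) ∉ S) (hT0 : (0:F) ∉ T) (Γ : Finset (F × F))
    (hΓ : Γ ⊆ S ×ˢ T) (N H : ℝ) (hΓne : Γ.Nonempty)
    (hDN : (D.card : ℝ) ≤ N) (hQN : (Q.card : ℝ) ≤ N)
    (hD : ∀ p ∈ Γ, p.1 - p.2 ∈ D) (hQ : ∀ p ∈ Γ, p.1 / p.2 ∈ Q)
    (hH : 128 * N ^ 2 * (T.card : ℝ) ^ 2 * (S.card : ℝ) ^ 2 ≤ H * (Γ.card : ℝ) ^ 3) :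
    ∃ A ⊆ S, A.Nonempty ∧ (A.card : ℝ) ≤ N ∧ (Γ.card : ℝ) ≤ 4 * T.card * A.card ∧
      ((A - A).card : ℝ) ≤ H ^ 2 * A.card ∧ ((A / A).card : ℝ) ≤ H ^ 2 * A.card ∧
      ∃ P ⊆ A ×ˢ A, (A.card : ℝ) ^ 2 ≤ 4 * P.card ∧
        ((P.image fun p => p.1 / p.2).card : ℝ) ≤ H * A.card := by
  obtain ⟨⟨s0, t00⟩, hst0⟩ := hΓne
  have hS : S.Nonempty := ⟨s0, (Finset.mem_product.1 (hΓ hst0)).1⟩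
  have hT : T.Nonempty := ⟨t00, (Finset.mem_product.1 (hΓ hst0)).2⟩
  have hSp : (0:ℝ) < S.card := by exact_mod_cast hS.card_pos
  have hTp : (0:ℝ) < T.card := by exact_mod_cast hT.card_pos
  have hep : (0:ℝ) < Γ.card := by exact_mod_cast Finset.card_pos.2 ⟨_, hst0⟩
  have hN0 : 0 ≤ N := le_trans (by positivity) hDN
  set e := (Γ.card : ℝ) with he
  set τ : ℝ := e ^ 2 / (32 * T.card * (S.card : ℝ) ^ 2) with hτdef
  have hτp : 0 < τ := by positivity
  set cod : F → F → ℕ := fun s w => (T.filter fun t => (s, t) ∈ Γ ∧ (w, t) ∈ Γ).card with hcod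
  set Nb : F → Finset F := fun t => S.filter fun s => (s, t) ∈ Γ with hNb
  have hτe : 32 * τ * T.card * (S.card : ℝ) ^ 2 = e ^ 2 := by
    rw [hτdef]; field_simp
  obtain ⟨t0, ht0, hmain⟩ := drc_choose S T Γ hΓ hT cod (fun _ _ => rfl) τ hτp.le hτe.le
    Nb (fun _ => rfl)
  set S' := Nb t0 with hS'
  set n := (S'.card : ℝ) with hn
  set bad := ((S' ×ˢ S').filter fun p => (cod p.1 p.2 : ℝ) < τ) with hbad
  have hb0 : (0:ℝ) ≤ bad.card := Nat.cast_nonneg _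
  have hn0 : 0 ≤ n := Nat.cast_nonneg _
  have hne : e ≤ 2 * T.card * n := by
    have : e ^ 2 ≤ (2 * T.card * n) ^ 2 := by
      have := sq_nonneg ((T.card : ℝ) * n)
      have : 0 ≤ (T.card : ℝ) ^ 2 * (bad.card : ℝ) := mul_nonneg (sq_nonneg _) hb0
      nlinarith only [this, hmain, sq_nonneg ((T.card : ℝ) * n)]
    exact le_of_sq_le_sq this (mul_nonneg (mul_nonneg zero_le_two hTp.le) hn0)
  have hnp : 0 < n := by
    by_contra h
    have : n = 0 := le_antisymm (not_lt.1 h) hn0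
    rw [this] at hne; linarith only [hne, hep]
  have hbadle : 16 * (bad.card : ℝ) ≤ n ^ 2 := by
    have h1 : 0 < 2 * (T.card : ℝ) ^ 2 * (n ^ 2 - 16 * bad.card) :=
      lt_of_lt_of_le (pow_pos hep 2) hmain
    have := (mul_pos_iff_of_pos_left (mul_pos zero_lt_two (pow_pos hTp 2))).1 h1
    linarith only [this]
  have hS'S : S' ⊆ S := Finset.filter_subset _ _
  have hnN : n ≤ N := by
    refine le_trans ?_ hDN
    rw [hn]
    norm_cast
    apply Finset.card_le_card_of_injOn (fun s => s - t0)
    · intro s hs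
      exact hD (s, t0) (Finset.mem_filter.1 hs).2
    · intro s _ s' _ h
      exact sub_left_injective h
  set good : F → F → Prop := fun s w => τ ≤ (cod s w : ℝ) with hgood
  have hgs : ∀ s w, good s w → good w s := by
    intro s w h
    have : cod w s = cod s w := by
      simp only [hcod]; congr 1; ext t; simp [and_comm]
    simp only [hgood, this]; exact h
  set bp : F → Finset F := fun s => S'.filter fun w => ¬ good s w with hbp
  set A := S'.filter fun s => ((bp s).card : ℝ) ≤ n / 4 with hAdef
  have hAS' : A ⊆ S' := Finset.filter_subset _ _
  have hAn : (A.card : ℝ) ≤ n := by rw [hn]; exact_mod_cast Finset.card_le_card hAS'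
  have hAlow : 3 / 4 * n ≤ A.card := by
    have h1 := fib_lower bad (S' \ A) Prod.fst (n / 4) (by
      intro s hs
      rw [Finset.mem_sdiff] at hs
      have h2 : ¬ ((bp s).card : ℝ) ≤ n / 4 := fun h => hs.2 (Finset.mem_filter.2 ⟨hs.1, h⟩)
      refine (not_le.1 h2).le.trans ?_
      norm_cast
      apply Finset.card_le_card_of_injOn (fun w => (s, w))
      · intro w hw
        have hw := Finset.mem_filter.1 hw
        rw [Finset.mem_coe, Finset.mem_filter, hbad, Finset.mem_filter, Finset.mem_product]
        exact ⟨⟨⟨hs.1, hw.1⟩, not_le.1 hw.2⟩, rfl⟩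
      · intro w _ w' _ h
        exact (Prod.ext_iff.1 h).2)
    have h2 : (S' \ A).card + A.card = S'.card := Finset.card_sdiff_add_card_eq_card hAS'
    have h3 : ((S' \ A).card : ℝ) + A.card = n := by rw [hn]; exact_mod_cast h2
    have h4 : n / 4 * ((S' \ A).card : ℝ) ≤ n / 4 * (n / 4) := by nlinarith only [h1, hbadle]
    have h5 := le_of_mul_le_mul_left h4 (div_pos hnp zero_lt_four)
    linarith only [h5, h3]
  have hAp : (0:ℝ) < A.card := by linarith only [hAlow, hnp]
  have hS'0 : ∀ s ∈ S', s ≠ 0 := fun s hs h => hS0 (h ▸ hS'S hs)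
  have hT' : ∀ t ∈ T, t ≠ 0 := fun s hs h => hT0 (h ▸ hs)
  have hcommon : ∀ s ∈ A, ∀ s' ∈ A, ∃ W ⊆ S', n / 2 ≤ (W.card : ℝ) ∧
      ∀ w ∈ W, good s w ∧ good s' w := by
    intro s hs s' hs'
    refine ⟨S' \ (bp s ∪ bp s'), Finset.sdiff_subset, ?_, ?_⟩
    · have h1 : (bp s ∪ bp s') ⊆ S' :=
        Finset.union_subset (Finset.filter_subset _ _) (Finset.filter_subset _ _)
      have h2 := Finset.card_sdiff_add_card_eq_card h1
      have h3 : (((S' \ (bp s ∪ bp s')).card : ℝ)) + ((bp s ∪ bp s').card : ℝ) = n := by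
        rw [hn]; exact_mod_cast h2
      have h4 : ((bp s ∪ bp s').card : ℝ) ≤ (bp s).card + (bp s').card := by
        exact_mod_cast Finset.card_union_le _ _
      have h5 := (Finset.mem_filter.1 hs).2
      have h6 := (Finset.mem_filter.1 hs').2
      linarith only [h3, h4, h5, h6]
    · intro w hw
      rw [Finset.mem_sdiff, Finset.mem_union, not_or] at hw
      constructor
      · by_contra h
        exact hw.2.1 (Finset.mem_filter.2 ⟨hw.1, h⟩)
      · by_contra h
        exact hw.2.2 (Finset.mem_filter.2 ⟨hw.1, h⟩)
  have hsub := op_growth S' A D hAS' good (fun x y => x - y) τ n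
    (by intro s _ t t' _ _ h; exact sub_right_injective h)
    (by
      intro s _ w _ hsw
      refine ⟨T.filter fun t => (s, t) ∈ Γ ∧ (w, t) ∈ Γ, hsw, ?_⟩
      intro t ht
      have ht := Finset.mem_filter.1 ht
      exact ⟨hT' t ht.1, hD _ ht.2.1, hD _ ht.2.2, by ring⟩)
    (by
      intro s hs s' hs'
      obtain ⟨W, h1, h2, h3⟩ := hcommon s hs s' hs'
      exact ⟨W, h1, h2, fun w hw => ⟨hS'0 w (h1 hw), (h3 w hw).1, (h3 w hw).2, by ring⟩⟩)
  have hdiv := op_growth S' A Q hAS' good (fun x y => x / y) τ n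
    (by
      intro s hs t t' ht ht' h
      have := hS'0 s hs
      field_simp at h
      exact h.symm)
    (by
      intro s hs w hw hsw
      refine ⟨T.filter fun t => (s, t) ∈ Γ ∧ (w, t) ∈ Γ, hsw, ?_⟩
      intro t ht
      have ht := Finset.mem_filter.1 ht
      have h1 := hT' t ht.1
      have h2 := hS'0 w hw
      exact ⟨hT' t ht.1, hQ _ ht.2.1, hQ _ ht.2.2, by field_simp⟩)
    (by
      intro s hs s' hs'
      obtain ⟨W, h1, h2, h3⟩ := hcommon s hs s' hs'
      refine ⟨W, h1, h2, fun w hw => ⟨hS'0 w (h1 hw), (h3 w hw).1, (h3 w hw).2, ?_⟩⟩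
      have h4 := hS'0 w (h1 hw)
      have h5 := hS'0 s' (hAS' hs')
      field_simp)
  have hHtau : 2 * N ^ 2 ≤ H * τ * n := drc_num2 N H τ n _ _ e hTp hSp hep hτe hne hH
  have hgen : ∀ g : F → F → F, ∀ E : Finset F, (E.card : ℝ) ≤ N →
      (τ * (((S' ×ˢ S').filter fun p => good p.1 p.2).image fun p => g p.1 p.2).card ≤
      (E.card : ℝ) ^ 2 ∧
    (n / 2) * (Finset.image₂ g A A).card ≤
      ((((S' ×ˢ S').filter fun p => good p.1 p.2).image fun p => g p.1 p.2).card : ℝ) ^ 2) →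
      2 * ((((S' ×ˢ S').filter fun p => good p.1 p.2).image fun p => g p.1 p.2).card : ℝ) ≤ H * n ∧
      ((Finset.image₂ g A A).card : ℝ) ≤ H ^ 2 * A.card := by
    rintro g E hE ⟨h1, h2⟩
    exact drc_num1 N H τ n _ _ _ _ (Nat.cast_nonneg _) hE (Nat.cast_nonneg _) hτp hnp hAlow hHtau h1 h2
  obtain ⟨hs1, hs2⟩ := hgen _ D hDN hsub
  obtain ⟨hd1, hd2⟩ := hgen _ Q hQN hdiv
  refine ⟨A, hAS'.trans hS'S, Finset.card_pos.1 (by exact_mod_cast hAp), hAn.trans hnN, ?_,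
    hs2, hd2, (A ×ˢ A).filter fun p => good p.1 p.2, Finset.filter_subset _ _, ?_, ?_⟩
  · have : (T.card : ℝ) * (3 / 4 * n) ≤ T.card * A.card := by gcongr
    have h0 : 0 ≤ (T.card : ℝ) * n := mul_nonneg hTp.le hn0
    nlinarith only [this, hne, h0]
  · have h1 : (A ×ˢ A).filter (fun p => ¬ good p.1 p.2) ⊆ bad := by
      intro p hp
      simp only [Finset.mem_filter, Finset.mem_product] at hp
      simp only [hbad, Finset.mem_filter, Finset.mem_product]
      exact ⟨⟨hAS' hp.1.1, hAS' hp.1.2⟩, not_le.1 hp.2⟩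
    have h2 := Finset.card_filter_add_card_filter_not (s := A ×ˢ A) (fun p => good p.1 p.2)
    rw [Finset.card_product] at h2
    have h3 : (((A ×ˢ A).filter fun p => good p.1 p.2).card : ℝ) +
        (((A ×ˢ A).filter fun p => ¬ good p.1 p.2).card : ℝ) = A.card * A.card := by
      exact_mod_cast h2
    have h4 : (((A ×ˢ A).filter fun p => ¬ good p.1 p.2).card : ℝ) ≤ bad.card := by
      exact_mod_cast Finset.card_le_card h1
    nlinarith only [h3, h4, hbadle, hAlow, hnp]
  · have h1 : ((A ×ˢ A).filter fun p => good p.1 p.2).image (fun p => p.1 / p.2) ⊆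
        ((S' ×ˢ S').filter fun p => good p.1 p.2).image fun p => p.1 / p.2 := by
      apply Finset.image_subset_image
      apply Finset.filter_subset_filter
      exact Finset.product_subset_product hAS' hAS'
    have h2 : ((((A ×ˢ A).filter fun p => good p.1 p.2).image (fun p => p.1 / p.2)).card : ℝ) ≤
        (((S' ×ˢ S').filter fun p => good p.1 p.2).image fun p => p.1 / p.2).card := by
      exact_mod_cast Finset.card_le_card h1
    have hH0 : 0 ≤ H := by
      have : 0 ≤ H * n := le_trans (mul_nonneg zero_le_two (Nat.cast_nonneg _)) hd1
      exact nonneg_of_mul_nonneg_left this hnp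
    nlinarith only [h2, hd1, mul_le_mul_of_nonneg_left hAlow hH0, mul_nonneg hH0 hn0]

structure Piv (A M : Finset F) (L k : ℝ) : Prop where
  hL : 1 ≤ L
  hk : 1 ≤ k
  hMA : M ⊆ A
  h0 : (0:F) ∉ A
  h1 : (1:F) ∈ M
  hM : (A.card : ℝ) ≤ k * M.card
  hI : ∀ μ ∈ M, (A.card : ℝ) ≤ k * (A.filter fun d => μ * d ∈ A).card
  hd : ((A - A).card : ℝ) ≤ L * A.card
  hq : ((A / A).card : ℝ) ≤ L * A.card

lemma Piv.Apos {A M : Finset F} {L k : ℝ} (h : Piv A M L k) : (0:ℝ) < A.card := by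
  exact_mod_cast Finset.card_pos.2 ⟨1, h.hMA h.h1⟩

lemma Piv.Mpos {A M : Finset F} {L k : ℝ} (h : Piv A M L k) : (0:ℝ) < M.card := by
  exact_mod_cast Finset.card_pos.2 ⟨1, h.h1⟩

lemma Piv.ne0 {A M : Finset F} {L k : ℝ} (h : Piv A M L k) {μ : F} (hμ : μ ∈ A) : μ ≠ 0 :=
  fun h2 => h.h0 (h2 ▸ hμ)

lemma Piv.cov1 {A M : Finset F} {L k : ℝ} (h : Piv A M L k) {μ : F} (hμ : μ ∈ M)
    (Y : Finset F) (hY : Y ⊆ A) :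
    ∃ Y' Z : Finset F, Y' ⊆ Y ∧ 7 * Y.card ≤ 8 * Y'.card ∧ (Z.card : ℝ) ≤ 8 * L * k ∧
      ∀ y ∈ Y', ∃ z ∈ Z, μ * y - z ∈ A := by
  have hμ0 := h.ne0 (h.hMA hμ)
  have hinj : Function.Injective (fun x : F => μ * x) := mul_right_injective₀ hμ0
  have hIc := h.hI μ hμ
  set I := (A.filter fun d => μ * d ∈ A).image (fun x => μ * x) with hI
  have hIcard : I.card = (A.filter fun d => μ * d ∈ A).card :=
    Finset.card_image_of_injective _ hinj
  rw [← hIcard] at hIc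
  have hIne : I.Nonempty := by
    rw [← Finset.card_pos]
    by_contra h2
    have : I.card = 0 := by omega
    rw [this] at hIc
    have := h.Apos
    simp at hIc
    simp [hIc] at this
  have hIA : I ⊆ A := by
    intro x hx
    obtain ⟨d, hd, rfl⟩ := Finset.mem_image.1 hx
    exact (Finset.mem_filter.1 hd).2
  obtain ⟨Y1, Z, h1, h2, h3, h4⟩ := cover (Y.image fun x => μ * x) I A
    ((A - A).image fun x => μ * x) hIA hIne (by
      intro y0 hy0 i hi
      obtain ⟨y, hy, rfl⟩ := Finset.mem_image.1 hy0
      obtain ⟨d, hd, rfl⟩ := Finset.mem_image.1 hi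
      refine Finset.mem_image.2 ⟨y - d, Finset.sub_mem_sub (hY hy) (Finset.mem_filter.1 hd).1, ?_⟩
      ring)
  rw [Finset.card_image_of_injective Y hinj] at h2
  rw [Finset.card_image_of_injective (A - A) hinj] at h3
  refine ⟨Y.filter fun y => μ * y ∈ Y1, Z, Finset.filter_subset _ _, ?_, ?_, ?_⟩
  · have : Y1.card ≤ (Y.filter fun y => μ * y ∈ Y1).card := by
      rw [← Finset.card_image_of_injective (Y.filter fun y => μ * y ∈ Y1) hinj]
      apply Finset.card_le_card
      intro x hx
      obtain ⟨y, hy, rfl⟩ := Finset.mem_image.1 (h1 hx)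
      exact Finset.mem_image.2 ⟨y, Finset.mem_filter.2 ⟨hy, hx⟩, rfl⟩
    omega
  · have hIp : (0:ℝ) < I.card := by exact_mod_cast hIne.card_pos
    have h3' : (Z.card : ℝ) * I.card ≤ 8 * (A - A).card := by exact_mod_cast h3
    have hL := h.hL
    have hk := h.hk
    have h5 : (Z.card : ℝ) * I.card ≤ (8 * L * k) * I.card := by
      have := h.hd
      have : L * (A.card : ℝ) ≤ L * (k * I.card) := by gcongr
      linarith
    exact le_of_mul_le_mul_right h5 hIp
  · intro y hy
    have := h4 (Finset.mem_filter.1 hy).2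
    obtain ⟨z, hz, a, ha, hza⟩ := Finset.mem_add.1 this
    exact ⟨z, hz, by rw [← hza]; simpa using ha⟩

lemma Piv.cov2 {A M : Finset F} {L k : ℝ} (h : Piv A M L k) {c d : F} (hc : c ∈ M) (hd : d ∈ M)
    (Y : Finset F) (hY : Y ⊆ A) :
    ∃ Y' Z : Finset F, Y' ⊆ Y ∧ 3 * Y.card ≤ 4 * Y'.card ∧ (Z.card : ℝ) ≤ (8 * L * k) ^ 2 ∧
      ∀ y ∈ Y', ∃ z ∈ Z, (c - d) * y - z ∈ A - A := by
  obtain ⟨Y1, Z1, a1, a2, a3, a4⟩ := h.cov1 hc Y hY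
  obtain ⟨Y2, Z2, b1, b2, b3, b4⟩ := h.cov1 hd Y hY
  refine ⟨Y1 ∩ Y2, Z1 - Z2, Finset.inter_subset_left.trans a1, ?_, ?_, ?_⟩
  · have e1 := Finset.card_union_add_card_inter Y1 Y2
    have e2 := Finset.card_le_card (Finset.union_subset a1 b1)
    omega
  · have e1 : ((Z1 - Z2).card : ℝ) ≤ Z1.card * Z2.card := by
      exact_mod_cast Finset.card_sub_le
    refine e1.trans ?_
    rw [sq]
    gcongr
    exact le_trans (Nat.cast_nonneg _) a3
  · intro y hy
    rw [Finset.mem_inter] at hy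
    obtain ⟨z1, hz1, e1⟩ := a4 y hy.1
    obtain ⟨z2, hz2, e2⟩ := b4 y hy.2
    refine ⟨z1 - z2, Finset.sub_mem_sub hz1 hz2, ?_⟩
    have : (c - d) * y - (z1 - z2) = (c * y - z1) - (d * y - z2) := by ring
    rw [this]
    exact Finset.sub_mem_sub e1 e2

lemma Piv.lemC {A M : Finset F} {L k : ℝ} (h : Piv A M L k) {a b c d : F} (ha : a ∈ M)
    (hb : b ∈ M) (hc : c ∈ M) (hd : d ∈ M)
    (Y W : Finset F) (hY : Y ⊆ A) (hW : W ⊆ A) :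
    ∃ Y' W' : Finset F, Y' ⊆ Y ∧ W' ⊆ W ∧ 3 * Y.card ≤ 4 * Y'.card ∧ 3 * W.card ≤ 4 * W'.card ∧
      (((Y' ×ˢ W').image fun p => (c - d) * p.1 + (a - b) * p.2).card : ℝ) ≤
        8 ^ 4 * L ^ 8 * k ^ 4 * A.card := by
  obtain ⟨Y', Z1, a1, a2, a3, a4⟩ := h.cov2 hc hd Y hY
  obtain ⟨W', Z2, b1, b2, b3, b4⟩ := h.cov2 ha hb W hW
  refine ⟨Y', W', a1, b1, a2, b2, ?_⟩
  have hsub : ((Y' ×ˢ W').image fun p => (c - d) * p.1 + (a - b) * p.2) ⊆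
      (Z1 + Z2) + (A - A + (A - A)) := by
    intro x hx
    obtain ⟨⟨y, w⟩, hp, rfl⟩ := Finset.mem_image.1 hx
    rw [Finset.mem_product] at hp
    obtain ⟨z1, hz1, e1⟩ := a4 y hp.1
    obtain ⟨z2, hz2, e2⟩ := b4 w hp.2
    refine Finset.mem_add.2 ⟨z1 + z2, Finset.add_mem_add hz1 hz2, _, Finset.add_mem_add e1 e2, ?_⟩
    simp only
    ring
  have e1 := card_two_sub_two A ⟨1, h.hMA h.h1⟩ L h.hd
  have e2 : ((Z1 + Z2 + (A - A + (A - A))).card : ℝ) ≤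
      Z1.card * Z2.card * (A - A + (A - A)).card := by
    have f1 : (Z1 + Z2 + (A - A + (A - A))).card ≤ (Z1 + Z2).card * (A - A + (A - A)).card :=
      Finset.card_add_le
    have f2 : (Z1 + Z2).card ≤ Z1.card * Z2.card := Finset.card_add_le
    exact_mod_cast f1.trans (Nat.mul_le_mul_right _ f2)
  have hL := h.hL
  have hk := h.hk
  calc (((Y' ×ˢ W').image fun p => (c - d) * p.1 + (a - b) * p.2).card : ℝ)
      ≤ (Z1 + Z2 + (A - A + (A - A))).card := by exact_mod_cast Finset.card_le_card hsub
    _ ≤ Z1.card * Z2.card * (A - A + (A - A)).card := e2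
    _ ≤ (8 * L * k) ^ 2 * (8 * L * k) ^ 2 * (L ^ 4 * A.card) := by gcongr
    _ = _ := by ring

lemma inj_of_notMem_quotSet {M : Finset F} {r : F} (hr : r ∉ quotSet M) {y w y' w' : F}
    (hy : y ∈ M) (hw : w ∈ M) (hy' : y' ∈ M) (hw' : w' ∈ M) (h : y + r * w = y' + r * w') :
    y = y' ∧ w = w' := by
  by_cases hww : w = w'
  · subst hww
    exact ⟨by simpa using h, rfl⟩
  · exfalso
    apply hr
    refine ⟨y', hy', y, hy, w, hw, w', hw', hww, ?_⟩
    rw [eq_div_iff (sub_ne_zero.2 hww)]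
    linear_combination h

lemma Piv.case1 {A M : Finset F} {L k : ℝ} (h : Piv A M L k) {ξ μ : F} (hξ : ξ ∈ quotSet M)
    (hμ : μ ∈ M) (hn : ξ * μ ∉ quotSet M) : (A.card : ℝ) ≤ 10 * 8 ^ 4 * L ^ 9 * k ^ 7 := by
  obtain ⟨a, ha, b, hb, c, hc, d, hd, hcd, rfl⟩ := hξ
  have hcd' := sub_ne_zero.2 hcd
  have hμ0 := h.ne0 (h.hMA hμ)
  have hinj : Function.Injective (fun x : F => μ * x) := mul_right_injective₀ hμ0
  set I0 := (A.filter fun d => μ * d ∈ A) with hI0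
  have hIc : (A.card : ℝ) ≤ k * I0.card := h.hI μ hμ
  obtain ⟨z0, hz0, hz⟩ := fib_pigeon (M ×ˢ I0) (A - A) (fun p => p.1 - p.2)
    ⟨1 - 1, Finset.sub_mem_sub (h.hMA h.h1) (h.hMA h.h1)⟩ (by
      intro p hp
      rw [Finset.mem_product] at hp
      exact Finset.sub_mem_sub (h.hMA hp.1) (Finset.mem_filter.1 hp.2).1)
  set Y2 := M.filter fun m => μ * m - μ * z0 ∈ A with hY2
  have hfib : ((M ×ˢ I0).filter fun p => p.1 - p.2 = z0).card ≤ Y2.card := by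
    apply Finset.card_le_card_of_injOn Prod.fst
    · intro p hp
      simp only [Finset.coe_filter, Finset.mem_product, Set.mem_ofPred_eq] at hp
      have : μ * p.1 - μ * z0 = μ * p.2 := by rw [← hp.2]; ring
      rw [hY2, Finset.mem_coe, Finset.mem_filter, this]
      exact ⟨hp.1.1, (Finset.mem_filter.1 hp.1.2).2⟩
    · intro p hp p' hp' hpp
      simp only [Finset.coe_filter, Finset.mem_product, Set.mem_ofPred_eq] at hp hp'
      refine Prod.ext hpp ?_
      have e1 := hp.2
      have e2 := hp'.2
      have e3 : p.1 = p'.1 := hpp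
      rw [e3] at e1
      linear_combination e2 - e1
  set W := Y2.image fun m => μ * m - μ * z0 with hW
  have hWA : W ⊆ A := by
    intro x hx
    obtain ⟨m, hm, rfl⟩ := Finset.mem_image.1 hx
    exact (Finset.mem_filter.1 hm).2
  have hWc : W.card = Y2.card := by
    apply Finset.card_image_of_injective
    intro x y hxy
    exact hinj (sub_left_injective hxy)
  obtain ⟨Y', W', hY', hW', c1, c2, hC⟩ := h.lemC ha hb hc hd M W h.hMA hWA
  have hlow : (Y' ×ˢ W').card =
      ((Y' ×ˢ W').image fun p => (c - d) * p.1 + (a - b) * p.2).card := by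
    symm
    apply Finset.card_image_of_injOn
    rintro ⟨y, w⟩ hp ⟨y', w'⟩ hp' hpp
    rw [Finset.mem_coe, Finset.mem_product] at hp hp'
    obtain ⟨m, hm, hmw⟩ := Finset.mem_image.1 (hW' hp.2)
    obtain ⟨m', hm', hmw'⟩ := Finset.mem_image.1 (hW' hp'.2)
    simp only at hpp hmw hmw'
    have e := inj_of_notMem_quotSet hn (hY' hp.1) (Finset.mem_filter.1 hm).1 (hY' hp'.1)
      (Finset.mem_filter.1 hm').1 (by
        rw [← hmw, ← hmw'] at hpp
        field_simp
        linear_combination hpp)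
    rw [e.2] at hmw
    exact Prod.ext e.1 (hmw.symm.trans hmw')
  rw [← hlow, Finset.card_product, Nat.cast_mul] at hC
  have hL := h.hL
  have hk := h.hk
  have hA := h.Apos
  have hM := h.hM
  have c1' : 3 * (M.card : ℝ) ≤ 4 * Y'.card := by exact_mod_cast c1
  have c2' : 3 * (Y2.card : ℝ) ≤ 4 * W'.card := by rw [← hWc]; exact_mod_cast c2
  have hz' : (M.card : ℝ) * I0.card ≤ Y2.card * (L * A.card) := by
    have hfib' : (((M ×ˢ I0).filter fun p => p.1 - p.2 = z0).card : ℝ) ≤ Y2.card := by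
      exact_mod_cast hfib
    rw [Finset.card_product] at hz
    push_cast at hz
    refine hz.trans ?_
    have := h.hd
    gcongr
  clear_value I0 Y2
  generalize (A.card : ℝ) = n at *
  generalize (M.card : ℝ) = m at *
  have hi0 : (0:ℝ) ≤ I0.card := Nat.cast_nonneg _
  generalize (I0.card : ℝ) = i at *
  have hy0 : (0:ℝ) ≤ Y2.card := Nat.cast_nonneg _
  generalize (Y2.card : ℝ) = y2 at *
  generalize (W'.card : ℝ) = w at *
  generalize (Y'.card : ℝ) = y at *
  -- numerics
  have g1 : m * n ≤ k * (m * i) := by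
    have hm0 : 0 ≤ m := by
      by_contra hneg
      nlinarith
    nlinarith
  have g2 : m * n ≤ (k * L * y2) * n := by
    calc m * n ≤ k * (m * i) := g1
      _ ≤ k * (y2 * (L * n)) := by gcongr
      _ = _ := by ring
  have g3 : m ≤ k * L * y2 := le_of_mul_le_mul_right g2 hA
  have hm0 : 0 ≤ m := by
    by_contra hneg
    nlinarith
  have g4 : 9 * (m * y2) ≤ 16 * (y * w) := by
    have : (3 * m) * (3 * y2) ≤ (4 * y) * (4 * w) := by
      apply mul_le_mul c1' c2' (by positivity) (by linarith)
    linarith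
  have g5 : n * n ≤ k ^ 3 * L * (m * y2) := by
    calc n * n ≤ (k * m) * (k * m) := by gcongr
      _ ≤ (k * m) * (k * (k * L * y2)) := by gcongr
      _ = _ := by ring
  have g6 : n * n ≤ (2 * 8 ^ 4 * L ^ 9 * k ^ 7) * n := by
    calc n * n ≤ k ^ 3 * L * (m * y2) := g5
      _ ≤ k ^ 3 * L * (2 * (8 ^ 4 * L ^ 8 * k ^ 4 * n)) := by
        have : 0 ≤ 8 ^ 4 * L ^ 8 * k ^ 4 * n := by positivity
        apply mul_le_mul_of_nonneg_left _ (by positivity)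
        linarith
      _ = _ := by ring
  have g7 := le_of_mul_le_mul_right g6 hA
  refine g7.trans ?_
  gcongr
  norm_num

lemma Piv.case2 {A M : Finset F} {L k : ℝ} (h : Piv A M L k) {ξ : F} (hξ : ξ ∈ quotSet M)
    (hn : ξ - 1 ∉ quotSet M) : (A.card : ℝ) ≤ 10 * 8 ^ 4 * L ^ 9 * k ^ 7 := by
  obtain ⟨a, ha, b, hb, c, hc, d, hd, hcd, rfl⟩ := hξ
  have hcd' := sub_ne_zero.2 hcd
  set ξ := (a - b) / (c - d) with hξ
  obtain ⟨Y', W', hY', hW', c1, c2, hC⟩ := h.lemC ha hb hc hd M M h.hMA h.hMA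
  have hY'ne : Y'.Nonempty := by
    rw [← Finset.card_pos]
    have : 0 < M.card := Finset.card_pos.2 ⟨1, h.h1⟩
    omega
  obtain ⟨X, hX, hXne, hXc⟩ := plunnecke_two Y' (-W') (W'.image fun w => ξ * w) hY'ne
  have e1 : X.card * W'.card ≤ (X + -W' + W'.image fun w => ξ * w).card := by
    rw [← Finset.card_product]
    apply Finset.card_le_card_of_injOn (fun p => p.1 + (ξ - 1) * p.2)
    · rintro ⟨x, w⟩ hp
      rw [Finset.mem_coe, Finset.mem_product] at hp
      refine Finset.mem_add.2 ⟨x + -w, Finset.add_mem_add hp.1 (Finset.neg_mem_neg hp.2), ξ * w,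
        Finset.mem_image_of_mem _ hp.2, ?_⟩
      simp only
      ring
    · rintro ⟨y, w⟩ hp ⟨y', w'⟩ hp' hpp
      rw [Finset.mem_coe, Finset.mem_product] at hp hp'
      have e := inj_of_notMem_quotSet hn (hY' (hX hp.1)) (hW' hp.2) (hY' (hX hp'.1)) (hW' hp'.2) hpp
      exact Prod.ext e.1 e.2
  have e2 : (Y' + W'.image fun w => ξ * w).card ≤
      ((Y' ×ˢ W').image fun p => (c - d) * p.1 + (a - b) * p.2).card := by
    apply Finset.card_le_card_of_injOn (fun x => (c - d) * x)
    · intro x hx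
      obtain ⟨y, hy, u, hu, rfl⟩ := Finset.mem_add.1 hx
      obtain ⟨w, hw, rfl⟩ := Finset.mem_image.1 hu
      refine Finset.mem_image.2 ⟨(y, w), Finset.mem_product.2 ⟨hy, hw⟩, ?_⟩
      simp only [hξ]
      field_simp
    · intro x _ y _ hxy
      exact mul_right_injective₀ hcd' hxy
  have e3 : (Y' + -W').card ≤ (A - A).card := by
    rw [← sub_eq_add_neg]
    exact Finset.card_le_card (Finset.sub_subset_sub (hY'.trans h.hMA) (hW'.trans h.hMA))
  have e4 : W'.card * Y'.card ^ 2 ≤ 4 * (Y' + -W').card * (Y' + W'.image fun w => ξ * w).card := by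
    have : (W'.card * Y'.card ^ 2) * X.card ≤
        (4 * (Y' + -W').card * (Y' + W'.image fun w => ξ * w).card) * X.card := by
      refine le_trans ?_ hXc
      calc _ = X.card * W'.card * Y'.card ^ 2 := by ring
        _ ≤ _ := Nat.mul_le_mul_right _ e1
    exact Nat.le_of_mul_le_mul_right this hXne.card_pos
  have hL := h.hL
  have hk := h.hk
  have hA := h.Apos
  have hM := h.hM
  have c1' : 3 * (M.card : ℝ) ≤ 4 * Y'.card := by exact_mod_cast c1
  have c2' : 3 * (M.card : ℝ) ≤ 4 * W'.card := by exact_mod_cast c2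
  have e5 : (W'.card : ℝ) * (Y'.card : ℝ) ^ 2 ≤
      4 * (L * A.card) * (8 ^ 4 * L ^ 8 * k ^ 4 * A.card) := by
    have f1 : (W'.card : ℝ) * (Y'.card : ℝ) ^ 2 ≤
      4 * ((Y' + -W').card : ℝ) * ((Y' + W'.image fun w => ξ * w).card : ℝ) := by exact_mod_cast e4
    have f2 : ((Y' + -W').card : ℝ) ≤ L * A.card := le_trans (by exact_mod_cast e3) h.hd
    have f3 : ((Y' + W'.image fun w => ξ * w).card : ℝ) ≤ 8 ^ 4 * L ^ 8 * k ^ 4 * A.card :=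
      le_trans (by exact_mod_cast e2) hC
    refine f1.trans ?_
    gcongr
  have hm0 : (0:ℝ) < M.card := h.Mpos
  generalize (A.card : ℝ) = n at *
  generalize (M.card : ℝ) = m at *
  generalize (W'.card : ℝ) = w at *
  generalize (Y'.card : ℝ) = y at *
  have g1 : (3 * m) * (3 * m) ^ 2 ≤ (4 * w) * (4 * y) ^ 2 := by
    gcongr
    linarith
  have g2 : n * n ^ 2 ≤ (k * m) * (k * m) ^ 2 := by gcongr
  have g3 : 27 * (n * n ^ 2) ≤ k ^ 3 * (64 * (4 * (L * n) * (8 ^ 4 * L ^ 8 * k ^ 4 * n))) := by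
    calc 27 * (n * n ^ 2) ≤ 27 * ((k * m) * (k * m) ^ 2) := by gcongr
      _ = k ^ 3 * ((3 * m) * (3 * m) ^ 2) := by ring
      _ ≤ k ^ 3 * (64 * (w * y ^ 2)) := by
        apply mul_le_mul_of_nonneg_left _ (by positivity)
        linarith
      _ ≤ _ := by gcongr
  have g4 : n * (27 * n ^ 2) ≤ (10 * 8 ^ 4 * L ^ 9 * k ^ 7) * (27 * n ^ 2) := by
    have : 0 ≤ 8 ^ 4 * L ^ 9 * k ^ 7 * n ^ 2 := by positivity
    linarith
  exact le_of_mul_le_mul_right g4 (by positivity)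

lemma subfield_of_closed [Fintype F] (M : Finset F) (R : Set F) (hM0 : ∀ m ∈ M, m ≠ 0)
    (h0 : (0:F) ∈ R) (hneg : ∀ x ∈ R, -x ∈ R) (hmul : ∀ x ∈ R, ∀ m ∈ M, x * m ∈ R)
    (hsub : ∀ x ∈ R, x - 1 ∈ R) :
    ∃ G : Subfield F, (∀ m ∈ M, m ∈ G) ∧ ∀ x ∈ G, x ∈ R := by
  have hmon : ∀ m ∈ Submonoid.closure (M : Set F), m ≠ 0 ∧ ∀ x ∈ R, x * m ∈ R := by
    intro m hm
    induction hm using Submonoid.closure_induction with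
    | mem m hm => exact ⟨hM0 m hm, fun x hx => hmul x hx m hm⟩
    | one => exact ⟨one_ne_zero, fun x hx => by simpa using hx⟩
    | mul a b _ _ ha hb =>
      refine ⟨mul_ne_zero ha.1 hb.1, fun x hx => ?_⟩
      rw [← mul_assoc]
      exact hb.2 _ (ha.2 x hx)
  have hinvpow : ∀ m : F, m ≠ 0 → m⁻¹ = m ^ (Fintype.card F - 2) := by
    intro m hm
    have h1 := FiniteField.pow_card_sub_one_eq_one m hm
    have h2 : 1 < Fintype.card F := Fintype.one_lt_card
    apply inv_eq_of_mul_eq_one_right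
    rw [← pow_succ']
    have : Fintype.card F - 2 + 1 = Fintype.card F - 1 := by omega
    rw [this, h1]
  have hring : ∀ x ∈ Subring.closure (M : Set F), ∀ ξ ∈ R, ξ + x ∈ R := by
    intro x hx
    rw [Subring.mem_closure_iff] at hx
    induction hx using AddSubgroup.closure_induction with
    | mem m hm =>
      intro ξ hξ
      have hm1 := (hmon m hm).1
      have e1 : ξ * m⁻¹ ∈ R := by
        rw [hinvpow m hm1]
        exact (hmon _ (pow_mem hm _)).2 ξ hξ
      have e2 : -(-(ξ * m⁻¹) - 1) ∈ R := hneg _ (hsub _ (hneg _ e1))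
      have e3 := (hmon m hm).2 _ e2
      have : -(-(ξ * m⁻¹) - 1) * m = ξ + m := by field_simp; ring
      rwa [this] at e3
    | zero => intro ξ hξ; simpa using hξ
    | add a b _ _ ha hb =>
      intro ξ hξ
      rw [← add_assoc]
      exact hb _ (ha _ hξ)
    | neg a _ ha =>
      intro ξ hξ
      have := hneg _ (ha _ (hneg _ hξ))
      simpa [add_comm] using this
  let G : Subfield F := { Subring.closure (M : Set F) with
    inv_mem' := by
      intro x hx
      by_cases hx0 : x = 0
      · subst hx0; simp
      · rw [hinvpow x hx0]
        have hx' : x ∈ Subring.closure (M : Set F) := hx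
        exact (Subring.closure (M : Set F)).pow_mem hx' _ }
  refine ⟨G, fun m hm => ?_, fun x hx => ?_⟩
  · exact Subring.subset_closure (s := (M : Set F)) hm
  · have : x ∈ Subring.closure (M : Set F) := hx
    simpa using hring x this 0 h0

lemma cs_image {α β : Type*} (s : Finset α) (f : α → β) :
    (s.card : ℝ) ^ 2 ≤ (s.image f).card *
      (((s ×ˢ s).filter fun p => f p.1 = f p.2).card : ℝ) := by
  have h1 : (s.card : ℝ) = ∑ y ∈ s.image f, ((s.filter fun x => f x = y).card : ℝ) := by
    rw [Finset.card_eq_sum_card_fiberwise (f := f) (s := s) (t := s.image f)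
      (fun x hx => Finset.mem_image_of_mem f hx)]
    push_cast; rfl
  have h2 : (((s ×ˢ s).filter fun p => f p.1 = f p.2).card : ℝ) =
      ∑ y ∈ s.image f, ((s.filter fun x => f x = y).card : ℝ) ^ 2 := by
    rw [Finset.card_eq_sum_card_fiberwise (f := fun p => f p.1)
      (s := (s ×ˢ s).filter fun p => f p.1 = f p.2) (t := s.image f) ?_]
    · push_cast
      apply Finset.sum_congr rfl
      intro y _
      rw [sq]
      norm_cast
      rw [← Finset.card_product]
      congr 1
      ext p
      simp only [Finset.mem_filter, Finset.mem_product]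
      constructor
      · rintro ⟨⟨⟨a, b⟩, c⟩, d⟩
        exact ⟨⟨a, d⟩, b, c ▸ d⟩
      · rintro ⟨⟨a, d⟩, b, c⟩
        exact ⟨⟨⟨a, b⟩, d.trans c.symm⟩, d⟩
    · intro p hp
      simp only [Finset.coe_filter, Finset.mem_product, Set.mem_ofPred_eq] at hp
      exact Finset.mem_image_of_mem f hp.1.1
  rw [h2]
  nth_rewrite 1 [h1]
  exact sq_sum_le_card_mul_sum_sq

lemma exists_low_energy (M G : Finset F) (hG : G.Nonempty) :
    ∃ ξ ∈ G, ((((M ×ˢ M) ×ˢ (M ×ˢ M)).filter fun p =>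
      p.1.1 + ξ * p.1.2 = p.2.1 + ξ * p.2.2).card : ℝ) * G.card ≤
      G.card * (M.card : ℝ) ^ 2 + (M.card : ℝ) ^ 4 := by
  by_contra! hcon
  have hGp : (0:ℝ) < G.card := by exact_mod_cast hG.card_pos
  set E : F → ℕ := fun ξ => (((M ×ˢ M) ×ˢ (M ×ˢ M)).filter fun p =>
      p.1.1 + ξ * p.1.2 = p.2.1 + ξ * p.2.2).card with hE
  have h1 : ∑ ξ ∈ G, (G.card * (M.card : ℝ) ^ 2 + (M.card : ℝ) ^ 4) <
      ∑ ξ ∈ G, (E ξ : ℝ) * G.card := Finset.sum_lt_sum_of_nonempty hG hcon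
  rw [← Finset.sum_mul, Finset.sum_const, nsmul_eq_mul] at h1
  have h2 : ∑ ξ ∈ G, (E ξ : ℝ) ≤ G.card * (M.card : ℝ) ^ 2 + (M.card : ℝ) ^ 4 := by
    have e1 : ∀ ξ ∈ G, (E ξ : ℝ) = ∑ p ∈ (M ×ˢ M) ×ˢ (M ×ˢ M),
        if p.1.1 + ξ * p.1.2 = p.2.1 + ξ * p.2.2 then (1:ℝ) else 0 := by
      intro ξ _
      rw [← Finset.sum_filter, Finset.sum_const, nsmul_eq_mul, mul_one]
    rw [Finset.sum_congr rfl e1, Finset.sum_comm]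
    have e2 : ∀ p ∈ (M ×ˢ M) ×ˢ (M ×ˢ M),
        (∑ ξ ∈ G, if p.1.1 + ξ * p.1.2 = p.2.1 + ξ * p.2.2 then (1:ℝ) else 0) ≤
        (if p.1 = p.2 then (G.card : ℝ) else 0) + 1 := by
      rintro ⟨⟨y, w⟩, ⟨y', w'⟩⟩ _
      rw [← Finset.sum_filter, Finset.sum_const, nsmul_eq_mul, mul_one]
      simp only [Prod.mk.injEq]
      split_ifs with hif
      · have : ((G.filter fun ξ => y + ξ * w = y' + ξ * w').card : ℝ) ≤ G.card := by
          exact_mod_cast Finset.card_filter_le _ _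
        linarith
      · rw [zero_add]
        norm_cast
        rw [Finset.card_le_one]
        intro ξ hξ η hη
        have h3 := (Finset.mem_filter.1 hξ).2
        have h4 := (Finset.mem_filter.1 hη).2
        by_contra hne
        have h5 : (ξ - η) * (w - w') = 0 := by linear_combination h3 - h4
        rcases mul_eq_zero.1 h5 with h6 | h6
        · exact hne (sub_eq_zero.1 h6)
        · have h7 := sub_eq_zero.1 h6
          apply hif
          subst h7
          exact ⟨by simpa using h3, rfl⟩
    refine (Finset.sum_le_sum e2).trans ?_
    rw [Finset.sum_add_distrib, ← Finset.sum_filter, Finset.sum_const, Finset.sum_const]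
    simp only [nsmul_eq_mul, mul_one, Finset.card_product]
    have e3 : (((M ×ˢ M) ×ˢ (M ×ˢ M)).filter fun p => p.1 = p.2).card ≤ (M ×ˢ M).card := by
      apply Finset.card_le_card_of_injOn Prod.fst
      · intro p hp
        simp only [Finset.coe_filter, Set.mem_ofPred_eq] at hp
        exact (Finset.mem_product.1 hp.1).1
      · intro p hp p' hp' hpp
        simp only [Finset.coe_filter, Set.mem_ofPred_eq] at hp hp'
        refine Prod.ext hpp ?_
        rw [← hp.2, ← hp'.2]; exact hpp
    rw [Finset.card_product] at e3
    have e4 : ((((M ×ˢ M) ×ˢ (M ×ˢ M)).filter fun p => p.1 = p.2).card : ℝ) ≤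
      M.card * M.card := by exact_mod_cast e3
    have e5 : ((((M ×ˢ M) ×ˢ (M ×ˢ M)).filter fun p => p.1 = p.2).card : ℝ) * G.card ≤
      (M.card * M.card) * G.card := by gcongr
    push_cast
    nlinarith only [e5]
  have h3 : (∑ ξ ∈ G, (E ξ : ℝ)) * G.card ≤ (G.card * (M.card : ℝ) ^ 2 + (M.card : ℝ) ^ 4) * G.card :=
    mul_le_mul_of_nonneg_right h2 hGp.le
  linarith

lemma Piv.case3 [Fintype F] {A M : Finset F} {L k : ℝ} (h : Piv A M L k) (G : Subfield F)
    (hMG : ∀ m ∈ M, m ∈ G) (hGR : ∀ x ∈ G, x ∈ quotSet M) :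
    (A.card : ℝ) ≤ 10 * 8 ^ 4 * L ^ 9 * k ^ 7 ∨
      ((Nat.card G : ℝ) ≤ 7 * 8 ^ 4 * L ^ 8 * k ^ 4 * A.card ∧
        ((A.filter fun x => x ∉ G).card : ℝ) ≤ (L * k) ^ 2) := by
  set Gf : Finset F := Finset.univ.filter fun x => x ∈ G with hGf
  have hGc : Nat.card G = Gf.card := by
    rw [hGf]
    rw [Nat.card_eq_fintype_card]
    exact Fintype.card_of_subtype _ (by intro x; simp)
  have hGp : (0:ℝ) < Gf.card := by
    exact_mod_cast Finset.card_pos.2 ⟨0, by simp [hGf, G.zero_mem]⟩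
  obtain ⟨ξ, hξG, hξ⟩ := exists_low_energy M Gf ⟨0, by simp [hGf, G.zero_mem]⟩
  have hξG' : ξ ∈ G := (Finset.mem_filter.1 hξG).2
  obtain ⟨a, ha, b, hb, c, hc, d, hd, hcd, hξe⟩ := hGR ξ hξG'
  have hcd' := sub_ne_zero.2 hcd
  obtain ⟨Y', W', hY', hW', c1, c2, hC⟩ := h.lemC ha hb hc hd M M h.hMA h.hMA
  have hcs := cs_image (Y' ×ˢ W') fun p => (c - d) * p.1 + (a - b) * p.2
  set E := (((M ×ˢ M) ×ˢ (M ×ˢ M)).filter fun p =>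
      p.1.1 + ξ * p.1.2 = p.2.1 + ξ * p.2.2).card with hE
  have e1 : (((Y' ×ˢ W') ×ˢ (Y' ×ˢ W')).filter fun p =>
      (c - d) * p.1.1 + (a - b) * p.1.2 = (c - d) * p.2.1 + (a - b) * p.2.2).card ≤ E := by
    apply Finset.card_le_card
    intro p hp
    simp only [Finset.mem_filter, Finset.mem_product] at hp ⊢
    refine ⟨⟨⟨hY' hp.1.1.1, hW' hp.1.1.2⟩, hY' hp.1.2.1, hW' hp.1.2.2⟩, ?_⟩
    rw [hξe]
    field_simp
    linear_combination hp.2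
  have hL := h.hL
  have hk := h.hk
  have hA := h.Apos
  have hM := h.hM
  have hMp := h.Mpos
  have c1' : 3 * (M.card : ℝ) ≤ 4 * Y'.card := by exact_mod_cast c1
  have c2' : 3 * (M.card : ℝ) ≤ 4 * W'.card := by exact_mod_cast c2
  have e1' : ((((Y' ×ˢ W') ×ˢ (Y' ×ˢ W')).filter fun p =>
      (c - d) * p.1.1 + (a - b) * p.1.2 = (c - d) * p.2.1 + (a - b) * p.2.2).card : ℝ) ≤ E := by
    exact_mod_cast e1
  have hnum : (A.card : ℝ) ≤ 10 * 8 ^ 4 * L ^ 9 * k ^ 7 ∨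
      (Gf.card : ℝ) ≤ 7 * 8 ^ 4 * L ^ 8 * k ^ 4 * A.card := by
    have f1 : ((Y'.card : ℝ) * W'.card) ^ 2 ≤ (8 ^ 4 * L ^ 8 * k ^ 4 * A.card) * E := by
      rw [Finset.card_product, Nat.cast_mul] at hcs
      refine hcs.trans ?_
      gcongr
    clear e1 e1' hcs hC hGR hMG hGf hGc hE
    have hE0 : (0:ℝ) ≤ E := Nat.cast_nonneg _
    generalize (A.card : ℝ) = n at *
    generalize (M.card : ℝ) = m at *
    generalize (W'.card : ℝ) = w at *
    generalize (Y'.card : ℝ) = y at *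
    generalize (Gf.card : ℝ) = g at *
    generalize (E : ℝ) = E at *
    have f2 : (9 * (m * m)) ^ 2 ≤ (16 * (y * w)) ^ 2 := by
      have : (3 * m) * (3 * m) ≤ (4 * y) * (4 * w) :=
        mul_le_mul c1' c2' (by positivity) (by linarith)
      have : 9 * (m * m) ≤ 16 * (y * w) := by linarith
      gcongr
    set B := 8 ^ 4 * L ^ 8 * k ^ 4 * n with hB
    have hBp : 0 < B := by positivity
    have f3 : 81 * m ^ 4 ≤ 256 * (B * E) := by nlinarith only [f1, f2]
    have f4 : 81 * m ^ 4 * g ≤ 256 * B * (g * m ^ 2 + m ^ 4) := by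
      calc 81 * m ^ 4 * g ≤ 256 * (B * E) * g := by gcongr
        _ = 256 * B * (E * g) := by ring
        _ ≤ _ := by gcongr
    rcases le_total (m ^ 2) g with hcase | hcase
    · left
      have f5 : (g * m ^ 2) * (81 * m ^ 2) ≤ (g * m ^ 2) * (512 * B) := by
        have : m ^ 2 * m ^ 2 ≤ g * m ^ 2 := by gcongr
        have := mul_le_mul_of_nonneg_left this (by positivity : 0 ≤ 256 * B)
        nlinarith only [f4, this]
      have f6 := le_of_mul_le_mul_left f5 (by positivity)
      have f7 : n ^ 2 ≤ k ^ 2 * (7 * B) := by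
        calc n ^ 2 ≤ (k * m) ^ 2 := by gcongr
          _ = k ^ 2 * m ^ 2 := by ring
          _ ≤ _ := by
            apply mul_le_mul_of_nonneg_left _ (by positivity)
            linarith only [f6, hBp]
      have f8 : n * n ≤ (7 * 8 ^ 4 * L ^ 8 * k ^ 6) * n := by
        rw [hB] at f7; nlinarith only [f7]
      have f9 := le_of_mul_le_mul_right f8 hA
      refine f9.trans ?_
      have : L ^ 8 ≤ L ^ 9 := pow_le_pow_right₀ hL (by norm_num)
      have : k ^ 6 ≤ k ^ 7 := pow_le_pow_right₀ hk (by norm_num)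
      gcongr
      norm_num
    · right
      have f5 : m ^ 4 * (81 * g) ≤ m ^ 4 * (512 * B) := by
        have : g * m ^ 2 ≤ m ^ 2 * m ^ 2 := by gcongr
        have := mul_le_mul_of_nonneg_left this (by positivity : 0 ≤ 256 * B)
        nlinarith only [f4, this]
      have f6 := le_of_mul_le_mul_left f5 (by positivity)
      have : 7 * 8 ^ 4 * L ^ 8 * k ^ 4 * n = 7 * B := by rw [hB]; ring
      rw [this]
      linarith only [f6, hBp]
  rcases hnum with hnum | hnum
  · exact Or.inl hnum
  right
  rw [hGc]
  refine ⟨hnum, ?_⟩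
  -- the classes
  set f1 : F → Set F := fun x => {y | y - x ∈ G} with hf1
  set f2 : F → Set F := fun x => {y | ∃ g ∈ G, g ≠ 0 ∧ y = g * x} with hf2
  have k1 := class_count A M (fun x y => x - y) f1 (by
      intro z _ m hm
      ext y
      simp only [hf1, Set.mem_ofPred_eq]
      have hmG := hMG m hm
      constructor
      · intro hy
        have := G.sub_mem hy hmG
        have e : y - (z - m) - m = y - z := by ring
        rwa [e] at this
      · intro hy
        have := G.add_mem hy hmG
        have e : y - z + m = y - (z - m) := by ring
        rwa [e] at this)
    (by intro z _ m _ m' _ hmm; exact sub_right_injective hmm)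
  have k2 := class_count A M (fun x y => x / y) f2 (by
      intro z _ m hm
      ext y
      simp only [hf2, Set.mem_ofPred_eq]
      have hmG := hMG m hm
      have hm0 := h.ne0 (h.hMA hm)
      constructor
      · rintro ⟨g, hg, hg0, rfl⟩
        exact ⟨g / m, G.div_mem hg hmG, div_ne_zero hg0 hm0, by field_simp⟩
      · rintro ⟨g, hg, hg0, rfl⟩
        exact ⟨g * m, G.mul_mem hg hmG, mul_ne_zero hg0 hm0, by field_simp⟩)
    (by
      intro z hz m hm m' hm' hmm
      have hz0 := h.ne0 hz
      have hm0 := h.ne0 (h.hMA hm)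
      have hm0' := h.ne0 (h.hMA hm')
      simp only at hmm
      field_simp at hmm
      exact hmm.symm)
  have k3 : ((A.image f1).card : ℝ) ≤ L * k := by
    have this' := k1.trans (Nat.cast_le.2 (Finset.card_le_card (t := A - A) (by
      intro x hx
      obtain ⟨u, hu, v, hv, rfl⟩ := Finset.mem_image₂.1 hx
      exact Finset.sub_mem_sub hu (h.hMA hv))))
    have := h.hd
    have g1 : L * (A.card : ℝ) ≤ L * (k * M.card) := by gcongr
    have g2 : ((A.image f1).card : ℝ) * M.card ≤ (L * k) * M.card := by
      refine le_trans ?_ (this.trans (g1.trans (le_of_eq (by ring))))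
      convert this'
    exact le_of_mul_le_mul_right g2 hMp
  have k4 : ((A.image f2).card : ℝ) ≤ L * k := by
    have this' := k2.trans (Nat.cast_le.2 (Finset.card_le_card (t := A / A) (by
      intro x hx
      obtain ⟨u, hu, v, hv, rfl⟩ := Finset.mem_image₂.1 hx
      exact Finset.div_mem_div hu (h.hMA hv))))
    have := h.hq
    have g1 : L * (A.card : ℝ) ≤ L * (k * M.card) := by gcongr
    have g2 : ((A.image f2).card : ℝ) * M.card ≤ (L * k) * M.card := by
      refine le_trans ?_ (this.trans (g1.trans (le_of_eq (by ring))))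
      convert this'
    exact le_of_mul_le_mul_right g2 hMp
  have k5 : (A.filter fun x => x ∉ G).card ≤ ((A.image f1) ×ˢ (A.image f2)).card := by
    apply Finset.card_le_card_of_injOn (fun x => (f1 x, f2 x))
    · intro x hx
      have hx := (Finset.mem_filter.1 hx).1
      exact Finset.mem_product.2 ⟨Finset.mem_image_of_mem _ hx, Finset.mem_image_of_mem _ hx⟩
    · intro x hx y hy hxy
      rw [Finset.mem_coe, Finset.mem_filter] at hx hy
      have g1 : f1 x = f1 y := (Prod.ext_iff.1 hxy).1
      have g2 : f2 x = f2 y := (Prod.ext_iff.1 hxy).2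
      have g3 : x ∈ f1 x := by simp [hf1, G.zero_mem]
      have g4 : x ∈ f2 x := ⟨1, G.one_mem, one_ne_zero, by ring⟩
      rw [g1] at g3
      rw [g2] at g4
      obtain ⟨g, hg, _, hgx⟩ := g4
      have g3' : x - y ∈ G := g3
      by_contra hne
      have hg1 : g - 1 ≠ 0 := by
        intro h0
        apply hne
        rw [hgx, sub_eq_zero.1 h0, one_mul]
      apply hy.2
      have : y = (x - y) / (g - 1) := by
        rw [eq_div_iff hg1, hgx]; ring
      rw [this]
      exact G.div_mem g3' (G.sub_mem hg G.one_mem)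
  rw [Finset.card_product] at k5
  calc ((A.filter fun x => x ∉ G).card : ℝ) ≤ (A.image f1).card * (A.image f2).card := by
        exact_mod_cast k5
    _ ≤ (L * k) * (L * k) := by gcongr
    _ = _ := by ring

lemma Piv.main [Fintype F] {A M : Finset F} {L k : ℝ} (h : Piv A M L k) :
    (A.card : ℝ) ≤ 10 * 8 ^ 4 * L ^ 9 * k ^ 7 ∨ ∃ G : Subfield F,
      ((Nat.card G : ℝ) ≤ 7 * 8 ^ 4 * L ^ 8 * k ^ 4 * A.card ∧
        ((A.filter fun x => x ∉ G).card : ℝ) ≤ (L * k) ^ 2) := by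
  by_cases h1 : ∃ c ∈ M, c ≠ 1
  swap
  · left
    push Not at h1
    have : M ⊆ {1} := by
      intro x hx; simpa using h1 x hx
    have h2 : (M.card : ℝ) ≤ 1 := by exact_mod_cast Finset.card_le_card this
    have hL := h.hL
    have hk := h.hk
    have h3 : (A.card : ℝ) ≤ k := by
      have := h.hM
      nlinarith
    have e1 : k ≤ k ^ 7 := le_self_pow₀ hk (by norm_num)
    have e2 : 1 ≤ L ^ 9 := one_le_pow₀ hL
    nlinarith [mul_le_mul e2 e1 (by positivity) (by positivity)]
  obtain ⟨c, hc, hc1⟩ := h1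
  by_cases hc1' : ∃ ξ ∈ quotSet M, ∃ μ ∈ M, ξ * μ ∉ quotSet M
  · obtain ⟨ξ, hξ, μ, hμ, hn⟩ := hc1'
    exact Or.inl (h.case1 hξ hμ hn)
  by_cases hc2 : ∃ ξ ∈ quotSet M, ξ - 1 ∉ quotSet M
  · obtain ⟨ξ, hξ, hn⟩ := hc2
    exact Or.inl (h.case2 hξ hn)
  push Not at hc1' hc2
  obtain ⟨G, hG1, hG2⟩ := subfield_of_closed M (quotSet M) (fun m hm => h.ne0 (h.hMA hm))
    ⟨1, h.h1, 1, h.h1, c, hc, 1, h.h1, hc1, by simp⟩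
    (by
      rintro x ⟨a, ha, b, hb, c, hc, d, hd, hcd, rfl⟩
      exact ⟨b, hb, a, ha, c, hc, d, hd, hcd, by ring⟩)
    (fun x hx m hm => hc1' x hx m hm) hc2
  rcases h.case3 G hG1 hG2 with h3 | h3
  · exact Or.inl h3
  · exact Or.inr ⟨G, h3⟩

lemma pivot_wrap [Fintype F] (A : Finset F) (hA : A.Nonempty) (h0 : (0:F) ∉ A) (H : ℝ)
    (hH : 1 ≤ H) (hd : ((A - A).card : ℝ) ≤ H ^ 2 * A.card)
    (hq : ((A / A).card : ℝ) ≤ H ^ 2 * A.card)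
    (P : Finset (F × F)) (hP : P ⊆ A ×ˢ A) (hPc : (A.card : ℝ) ^ 2 ≤ 4 * P.card)
    (hPr : ((P.image fun p => p.1 / p.2).card : ℝ) ≤ H * A.card) :
    (A.card : ℝ) ≤ 10 * 8 ^ 4 * 32 ^ 7 * H ^ 25 ∨ ∃ (G : Subfield F) (a0 : F), a0 ≠ 0 ∧
      (Nat.card G : ℝ) ≤ 7 * 8 ^ 4 * 32 ^ 4 * H ^ 20 * A.card ∧
      ((A.filter fun x => x / a0 ∉ G).card : ℝ) ≤ 32 ^ 2 * H ^ 6 := by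
  have hAp : (0:ℝ) < A.card := by exact_mod_cast hA.card_pos
  have ne0 : ∀ {x}, x ∈ A → x ≠ 0 := fun hx h => h0 (h ▸ hx)
  have hcs := cs_image P (fun p => p.1 / p.2)
  set W := (P ×ˢ P).filter fun p => p.1.1 / p.1.2 = p.2.1 / p.2.2 with hW
  have hWP : ∀ w ∈ W, w.1.1 ∈ A ∧ w.1.2 ∈ A ∧ w.2.1 ∈ A ∧ w.2.2 ∈ A ∧
      w.1.1 / w.1.2 = w.2.1 / w.2.2 := by
    intro w hw
    rw [hW, Finset.mem_filter, Finset.mem_product] at hw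
    have h1 := Finset.mem_product.1 (hP hw.1.1)
    have h2 := Finset.mem_product.1 (hP hw.1.2)
    exact ⟨h1.1, h1.2, h2.1, h2.2, hw.2⟩
  obtain ⟨a0, ha0, hpig⟩ := fib_pigeon W A (fun w => w.2.1) hA (fun w hw => (hWP w hw).2.2.1)
  have ha00 := ne0 ha0
  set r : F → ℝ := fun a => ((A.filter fun d => (a / a0) * d ∈ A).card : ℝ) with hr
  have hWr : ((W.filter fun w => w.2.1 = a0).card : ℝ) ≤ ∑ a ∈ A, r a := by
    have h1 : (W.filter fun w => w.2.1 = a0).card ≤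
        (A.sigma fun a => A.filter fun d => (a / a0) * d ∈ A).card := by
      apply Finset.card_le_card_of_injOn (fun w => ⟨w.1.1, w.2.2⟩)
      · intro w hw
        rw [Finset.mem_coe, Finset.mem_filter] at hw
        obtain ⟨x1, x2, x3, x4, x5⟩ := hWP w hw.1
        simp only [Finset.coe_sigma, Set.mem_sigma_iff, Finset.mem_coe, Finset.mem_filter]
        refine ⟨x1, x4, ?_⟩
        have y2 := ne0 x2
        have y4 := ne0 x4
        rw [hw.2] at x5
        have : w.1.1 / a0 * w.2.2 = w.1.2 := by
          field_simp at x5 ⊢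
          linear_combination x5
        rwa [this]
      · intro w hw v hv hwv
        rw [Finset.mem_coe, Finset.mem_filter] at hw hv
        obtain ⟨x1, x2, x3, x4, x5⟩ := hWP w hw.1
        obtain ⟨z1, z2, z3, z4, z5⟩ := hWP v hv.1
        simp only [Sigma.mk.injEq, heq_eq_eq] at hwv
        have y2 := ne0 x2
        have y4 := ne0 x4
        have u2 := ne0 z2
        have u4 := ne0 z4
        rw [hw.2] at x5
        rw [hv.2] at z5
        rw [hwv.1, hwv.2, ← z5] at x5
        have y1 := ne0 z1
        have : w.1.2 = v.1.2 := by
          field_simp at x5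
          exact x5.symm
        refine Prod.ext (Prod.ext hwv.1 this) (Prod.ext (hw.2.trans hv.2.symm) hwv.2)
    rw [Finset.card_sigma] at h1
    simp only [hr]
    exact_mod_cast h1
  have hru : ∀ a ∈ A, r a ≤ A.card := by
    intro a _
    exact Nat.cast_le.2 (Finset.card_filter_le _ _)
  have hpop := popular A r A.card (A.card / (32 * H)) hru (by positivity)
  set A' := A.filter fun a => (A.card : ℝ) / (32 * H) ≤ r a with hA'
  have ha0' : a0 ∈ A' := by
    rw [hA', Finset.mem_filter]
    refine ⟨ha0, ?_⟩
    have : r a0 = A.card := by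
      simp only [hr]
      congr 2
      rw [Finset.filter_eq_self]
      intro x hx
      rwa [div_self ha00, one_mul]
    rw [this]
    apply div_le_self hAp.le
    linarith only [hH]
  have hA'c : (A.card : ℝ) ≤ 32 * H * A'.card := by
    generalize (W.filter fun w => w.2.1 = a0).card = w0 at hWr hpig
    have e1 : (P.card : ℝ) ^ 2 ≤ H * A.card * W.card :=
      hcs.trans (mul_le_mul_of_nonneg_right hPr (Nat.cast_nonneg _))
    have e2 : (W.card : ℝ) ≤ (A.card * A'.card + A.card / (32 * H) * A.card) * A.card :=
      hpig.trans (mul_le_mul_of_nonneg_right (hWr.trans hpop) (Nat.cast_nonneg _))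
    generalize (A.card : ℝ) = a at *
    generalize (A'.card : ℝ) = a' at *
    generalize (W.card : ℝ) = w at *
    have hp0 : (0:ℝ) ≤ P.card := Nat.cast_nonneg _
    generalize (P.card : ℝ) = p at *
    clear hpop hWr hpig hru hr hA' hWP hcs hd hq
    have e3 : a ^ 4 ≤ 16 * p ^ 2 := by nlinarith only [hPc, hp0, hAp]
    have e4 : H * a * w ≤ H * a * ((a * a' + a / (32 * H) * a) * a) :=
      mul_le_mul_of_nonneg_left e2 (by positivity)
    have e5 : H * a * ((a * a' + a / (32 * H) * a) * a) = H * a ^ 3 * a' + a ^ 4 / 32 := by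
      field_simp
    have e6 : a ^ 3 * a ≤ a ^ 3 * (32 * H * a') := by nlinarith only [e1, e3, e4, e5]
    exact le_of_mul_le_mul_left e6 (by positivity)
  set φ : F → F := fun x => x / a0 with hφ
  have hinj : Function.Injective φ := by
    intro x y hxy
    simp only [hφ] at hxy
    field_simp at hxy
    exact hxy
  have hAc : (A.image φ).card = A.card := Finset.card_image_of_injective A hinj
  have hpiv : Piv (A.image φ) (A'.image φ) (H ^ 2) (32 * H) := by
    refine ⟨one_le_pow₀ hH, by linarith only [hH], ?_, ?_, ?_, ?_, ?_, ?_, ?_⟩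
    · exact Finset.image_subset_image (Finset.filter_subset _ _)
    · intro h
      obtain ⟨x, hx, hx'⟩ := Finset.mem_image.1 h
      exact (div_ne_zero (ne0 hx) ha00) hx'
    · exact Finset.mem_image.2 ⟨a0, ha0', div_self ha00⟩
    · rw [hAc, Finset.card_image_of_injective A' hinj]
      exact hA'c
    · intro μ hμ
      obtain ⟨a, ha, rfl⟩ := Finset.mem_image.1 hμ
      have ha2 := (Finset.mem_filter.1 ha).2
      have h1 : (A.filter fun d => (a / a0) * d ∈ A).card ≤
          ((A.image φ).filter fun d => φ a * d ∈ A.image φ).card := by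
        rw [← Finset.card_image_of_injective (A.filter fun d => (a / a0) * d ∈ A) hinj]
        apply Finset.card_le_card
        intro y hy
        obtain ⟨d, hd', rfl⟩ := Finset.mem_image.1 hy
        rw [Finset.mem_filter] at hd' ⊢
        refine ⟨Finset.mem_image_of_mem _ hd'.1, Finset.mem_image.2 ⟨_, hd'.2, ?_⟩⟩
        simp only [hφ]
        ring
      have h1' : r a ≤ _ := Nat.cast_le.2 h1
      rw [hAc]
      have h2 := ha2.trans h1'
      rw [div_le_iff₀ (by linarith only [hH])] at h2
      linarith only [h2]
    · rw [hAc]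
      refine le_trans (Nat.cast_le.2 ?_) hd
      rw [← Finset.card_image_of_injective (A - A) hinj]
      apply Finset.card_le_card
      intro y hy
      obtain ⟨u, hu, v, hv, rfl⟩ := Finset.mem_sub.1 hy
      obtain ⟨u', hu', rfl⟩ := Finset.mem_image.1 hu
      obtain ⟨v', hv', rfl⟩ := Finset.mem_image.1 hv
      refine Finset.mem_image.2 ⟨u' - v', Finset.sub_mem_sub hu' hv', ?_⟩
      simp only [hφ]
      ring
    · rw [hAc]
      refine le_trans (Nat.cast_le.2 (Finset.card_le_card ?_)) hq
      intro y hy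
      obtain ⟨u, hu, v, hv, rfl⟩ := Finset.mem_div.1 hy
      obtain ⟨u', hu', rfl⟩ := Finset.mem_image.1 hu
      obtain ⟨v', hv', rfl⟩ := Finset.mem_image.1 hv
      refine Finset.mem_div.2 ⟨u', hu', v', hv', ?_⟩
      have := ne0 hv'
      simp only [hφ]
      field_simp
  rcases hpiv.main with h | ⟨G, hG1, hG2⟩
  · left
    rw [hAc] at h
    refine h.trans (le_of_eq (by ring))
  · right
    refine ⟨G, a0, ha00, ?_, ?_⟩
    · rw [hAc] at hG1
      refine hG1.trans (le_of_eq (by ring))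
    · have h1 : (A.filter fun x => x / a0 ∉ G).card ≤ ((A.image φ).filter fun x => x ∉ G).card := by
        rw [← Finset.card_image_of_injective (A.filter fun x => x / a0 ∉ G) hinj]
        apply Finset.card_le_card
        intro y hy
        obtain ⟨d, hd', rfl⟩ := Finset.mem_image.1 hy
        rw [Finset.mem_filter] at hd' ⊢
        exact ⟨Finset.mem_image_of_mem _ hd'.1, hd'.2⟩
      refine (Nat.cast_le.2 h1).trans (hG2.trans (le_of_eq (by ring)))

lemma dyadic {α : Type*} (s : Finset α) (r : α → ℝ) (N K : ℝ) (hN : 0 < N) (hK : 1 ≤ K)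
    (hr : ∀ x ∈ s, r x ≤ N) (hs : (s.card : ℝ) ≤ N ^ 4) (hsum : N ^ 5 / K ≤ ∑ x ∈ s, r x) :
    ∃ κ : ℝ, 1 ≤ κ ∧ κ ≤ 4 * K ∧
      κ ^ 2 * N ^ 4 ≤ 16 * K ^ 2 * ((s.filter fun x => N / (2 * κ) < r x).card : ℝ) := by
  by_contra! hcon
  obtain ⟨n, hn1, hn2⟩ := exists_nat_pow_near (x := 4 * K) (y := (2:ℝ)) (by linarith) (by norm_num)
  have hpt : ∀ x ∈ s, ∀ j : ℕ, r x ≤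
      ∑ i ∈ Finset.range j, (N / 2 ^ i) * (if N / (2 * 2 ^ i) < r x then 1 else 0) + N / 2 ^ j := by
    intro x hx j
    induction j with
    | zero => simpa using hr x hx
    | succ j ih =>
      rw [Finset.sum_range_succ]
      have h0 : 0 ≤ ∑ i ∈ Finset.range j,
          (N / 2 ^ i) * (if N / (2 * 2 ^ i) < r x then (1:ℝ) else 0) := by
        apply Finset.sum_nonneg
        intro i _
        split_ifs <;> positivity
      have h1 : 0 < N / 2 ^ (j + 1) := by positivity
      split_ifs with h
      · linarith
      · push Not at h
        have : N / (2 * 2 ^ j) = N / 2 ^ (j + 1) := by rw [pow_succ]; ring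
        linarith
  have h1 : ∑ x ∈ s, r x ≤ ∑ i ∈ Finset.range (n + 1), (N / 2 ^ i) *
      ((s.filter fun x => N / (2 * 2 ^ i) < r x).card : ℝ) + s.card * (N / 2 ^ (n + 1)) := by
    have := Finset.sum_le_sum (fun x hx => hpt x hx (n + 1))
    refine this.trans (le_of_eq ?_)
    rw [Finset.sum_add_distrib, Finset.sum_comm, Finset.sum_const, nsmul_eq_mul]
    congr 1
    apply Finset.sum_congr rfl
    intro i _
    rw [← Finset.mul_sum, Finset.sum_boole]
  have h2 : ∀ i ∈ Finset.range (n + 1), (N / 2 ^ i) *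
      ((s.filter fun x => N / (2 * 2 ^ i) < r x).card : ℝ) ≤ N ^ 5 / (16 * K ^ 2) * 2 ^ i := by
    intro i hi
    have hi' : (2:ℝ) ^ i ≤ 2 ^ n := pow_le_pow_right₀ (by norm_num)
      (by rw [Finset.mem_range] at hi; omega)
    have := hcon (2 ^ i) (one_le_pow₀ (by norm_num)) (hi'.trans hn1)
    have hc : ((s.filter fun x => N / (2 * 2 ^ i) < r x).card : ℝ) ≤
        (2 ^ i) ^ 2 * N ^ 4 / (16 * K ^ 2) := by
      rw [le_div_iff₀ (by positivity)]
      linarith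
    calc _ ≤ (N / 2 ^ i) * ((2 ^ i) ^ 2 * N ^ 4 / (16 * K ^ 2)) :=
          mul_le_mul_of_nonneg_left hc (by positivity)
      _ = _ := by field_simp
  have h3 := Finset.sum_le_sum h2
  rw [← Finset.mul_sum] at h3
  have h4 : ∑ i ∈ Finset.range (n + 1), (2:ℝ) ^ i ≤ 8 * K := by
    rw [geom_sum_eq (by norm_num)]
    rw [pow_succ]
    linarith
  have h5 : N ^ 5 / (16 * K ^ 2) * ∑ i ∈ Finset.range (n + 1), (2:ℝ) ^ i ≤ N ^ 5 / K / 2 := by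
    calc _ ≤ N ^ 5 / (16 * K ^ 2) * (8 * K) := mul_le_mul_of_nonneg_left h4 (by positivity)
      _ = _ := by field_simp; ring
  have h6 : (s.card : ℝ) * (N / 2 ^ (n + 1)) ≤ N ^ 5 / K / 4 := by
    calc _ ≤ N ^ 4 * (N / (4 * K)) := by
          apply mul_le_mul hs _ (by positivity) (by positivity)
          apply div_le_div_of_nonneg_left hN.le (by positivity) hn2.le
      _ = _ := by field_simp
  have h7 : 0 < N ^ 5 / K := by positivity
  linarith

lemma pick_pair (X : Finset F) (R : F × F → F × F → Prop) (N ρ : ℝ) (hN : N = X.card)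
    (hρ : 0 < ρ) (hρN : 8 < ρ ^ 2 * N)
    (hcount : ρ * N ^ 4 ≤
      ((((X ×ˢ X) ×ˢ (X ×ˢ X)).filter fun w => R w.1 w.2).card : ℝ)) :
    ∃ u ∈ X, ∃ v ∈ X, ∃ v' ∈ X, v ≠ v' ∧
      ρ * N ^ 2 ≤ 2 * (((X ×ˢ X).filter fun q => R (u, v) q).card : ℝ) ∧
      ρ * N ^ 2 ≤ 2 * (((X ×ˢ X).filter fun q => R (u, v') q).card : ℝ) ∧
      (((X ×ˢ X).filter fun q => R (u, v) q).card : ℝ) *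
        (((X ×ˢ X).filter fun q => R (u, v') q).card : ℝ) ≤
        2 * N ^ 2 * (((X ×ˢ X).filter fun q => R (u, v) q ∧ R (u, v') q).card : ℝ) := by
  have hNp : 0 < N := by
    by_contra h
    push Not at h
    have : ρ ^ 2 * N ≤ 0 := mul_nonpos_of_nonneg_of_nonpos (by positivity) h
    linarith
  have hX : X.Nonempty := by
    rw [← Finset.card_pos]
    rw [hN] at hNp
    exact_mod_cast hNp
  obtain ⟨u, hu, hpig⟩ := fib_pigeon (((X ×ˢ X) ×ˢ (X ×ˢ X)).filter fun w => R w.1 w.2) X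
    (fun w => w.1.1) hX (fun w hw => by
      simp only [Finset.mem_filter, Finset.mem_product] at hw
      exact hw.1.1.1)
  set d : F → ℝ := fun v => (((X ×ˢ X).filter fun q => R (u, v) q).card : ℝ) with hd
  have hsum : ρ * N ^ 3 ≤ ∑ v ∈ X, d v := by
    have h1 : ((((X ×ˢ X) ×ˢ (X ×ˢ X)).filter fun w => R w.1 w.2).filter fun w => w.1.1 = u).card ≤
        (X.sigma fun v => (X ×ˢ X).filter fun q => R (u, v) q).card := by
      apply Finset.card_le_card_of_injOn (fun w => ⟨w.1.2, w.2⟩)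
      · intro w hw
        simp only [Finset.coe_filter, Finset.mem_filter, Finset.mem_product, Set.mem_ofPred_eq] at hw
        simp only [Finset.coe_sigma, Set.mem_sigma_iff, Finset.mem_coe, Finset.mem_filter,
          Finset.mem_product]
        refine ⟨hw.1.1.1.2, hw.1.1.2, ?_⟩
        rw [← hw.2]
        exact hw.1.2
      · intro w hw w' hw' hww
        rw [Finset.mem_coe, Finset.mem_filter] at hw hw'
        simp only [Sigma.mk.injEq, heq_eq_eq] at hww
        exact Prod.ext (Prod.ext (hw.2.trans hw'.2.symm) hww.1) hww.2
    rw [Finset.card_sigma] at h1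
    have h2 : ((((((X ×ˢ X) ×ˢ (X ×ˢ X)).filter fun w => R w.1 w.2).filter
        fun w => w.1.1 = u).card : ℕ) : ℝ) ≤ ∑ v ∈ X, d v := by
      simp only [hd]
      exact_mod_cast h1
    rw [← hN] at hpig
    have h3 := hcount.trans (hpig.trans (mul_le_mul_of_nonneg_right h2 hNp.le))
    have h4 : (ρ * N ^ 3) * N ≤ (∑ v ∈ X, d v) * N := by linarith
    exact le_of_mul_le_mul_right h4 hNp
  have hX2 : ((X ×ˢ X).card : ℝ) = N ^ 2 := by
    rw [Finset.card_product, hN]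
    push_cast
    ring
  have hpop := popular X d (N ^ 2) (ρ * N ^ 2 / 2) (fun v _ => by
    rw [← hX2]
    exact Nat.cast_le.2 (Finset.card_filter_le _ _)) (by positivity)
  set V := X.filter fun v => ρ * N ^ 2 / 2 ≤ d v with hV
  rw [← hN] at hpop
  have hVc : ρ * N / 2 ≤ V.card := by
    have : N ^ 2 * (ρ * N / 2) ≤ N ^ 2 * V.card := by nlinarith
    exact le_of_mul_le_mul_left this (by positivity)
  have hdV : ∀ v ∈ V, ρ * N ^ 2 / 2 ≤ d v := fun v hv => (Finset.mem_filter.1 hv).2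
  have hdp : ∀ v ∈ V, 0 < d v := fun v hv => lt_of_lt_of_le (by positivity) (hdV v hv)
  set e : F → F → ℝ := fun v v' =>
    (((X ×ˢ X).filter fun q => R (u, v) q ∧ R (u, v') q).card : ℝ) with he
  by_contra! hcon
  have hoff : ∀ v ∈ V, ∀ v' ∈ V, v ≠ v' → e v v' / (d v * d v') ≤ 1 / (2 * N ^ 2) := by
    intro v hv v' hv' hne
    have := hcon u hu v (Finset.mem_filter.1 hv).1 v' (Finset.mem_filter.1 hv').1 hne
      (by have := hdV v hv; simp only [hd] at this; linarith)
      (by have := hdV v' hv'; simp only [hd] at this; linarith)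
    have p1 := hdp v hv
    have p2 := hdp v' hv'
    rw [div_le_div_iff₀ (by positivity) (by positivity)]
    simp only [hd, he]
    linarith
  have hdiag : ∀ v ∈ V, e v v / (d v * d v) ≤ 2 / (ρ * N ^ 2) := by
    intro v hv
    have p1 := hdp v hv
    have p2 := hdV v hv
    have : e v v = d v := by simp only [he, hd, and_self]
    rw [this, div_le_div_iff₀ (by positivity) (by positivity)]
    nlinarith
  -- Cauchy-Schwarz
  set g : F × F → ℝ := fun q => ∑ v ∈ V, (if R (u, v) q then 1 / d v else 0) with hg
  have hg1 : ∑ q ∈ X ×ˢ X, g q = V.card := by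
    simp only [hg]
    rw [Finset.sum_comm]
    have : ∀ v ∈ V, ∑ q ∈ X ×ˢ X, (if R (u, v) q then 1 / d v else 0) = 1 := by
      intro v hv
      have p1 := hdp v hv
      rw [← Finset.sum_filter, Finset.sum_const, nsmul_eq_mul]
      simp only [hd] at p1 ⊢
      field_simp
    rw [Finset.sum_congr rfl this]
    simp
  have hg2 : ∑ q ∈ X ×ˢ X, g q ^ 2 = ∑ v ∈ V, ∑ v' ∈ V, e v v' / (d v * d v') := by
    have : ∀ q ∈ X ×ˢ X, g q ^ 2 = ∑ v ∈ V, ∑ v' ∈ V,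
        (if R (u, v) q ∧ R (u, v') q then 1 / (d v * d v') else 0) := by
      intro q _
      simp only [hg]
      rw [sq, Finset.sum_mul_sum]
      apply Finset.sum_congr rfl
      intro v _
      apply Finset.sum_congr rfl
      intro v' _
      by_cases h1 : R (u, v) q <;> by_cases h2 : R (u, v') q <;> simp [h1, h2, mul_comm]
    rw [Finset.sum_congr rfl this, Finset.sum_comm]
    apply Finset.sum_congr rfl
    intro v _
    rw [Finset.sum_comm]
    apply Finset.sum_congr rfl
    intro v' _
    rw [← Finset.sum_filter, Finset.sum_const, nsmul_eq_mul]
    simp only [he]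
    ring
  have hcs := sq_sum_le_card_mul_sum_sq (s := X ×ˢ X) (f := g)
  rw [hg1, hg2, hX2] at hcs
  have hb : ∑ v ∈ V, ∑ v' ∈ V, e v v' / (d v * d v') ≤
      ∑ v ∈ V, (2 / (ρ * N ^ 2) + V.card * (1 / (2 * N ^ 2))) := by
    apply Finset.sum_le_sum
    intro v hv
    rw [← Finset.add_sum_erase V _ hv]
    apply add_le_add (hdiag v hv)
    calc _ ≤ ∑ v' ∈ V.erase v, 1 / (2 * N ^ 2) := by
          apply Finset.sum_le_sum
          intro v' hv'
          rw [Finset.mem_erase] at hv'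
          exact hoff v hv v' hv'.2 hv'.1.symm
      _ ≤ ∑ v' ∈ V, 1 / (2 * N ^ 2) := by
          apply Finset.sum_le_sum_of_subset_of_nonneg (Finset.erase_subset _ _)
          intros; positivity
      _ = _ := by rw [Finset.sum_const, nsmul_eq_mul]
  rw [Finset.sum_const, nsmul_eq_mul] at hb
  have h1 : (V.card : ℝ) ^ 2 ≤ N ^ 2 * (V.card * (2 / (ρ * N ^ 2) + V.card * (1 / (2 * N ^ 2)))) :=
    hcs.trans (mul_le_mul_of_nonneg_left hb (by positivity))
  have h2 : N ^ 2 * ((V.card : ℝ) * (2 / (ρ * N ^ 2) + V.card * (1 / (2 * N ^ 2)))) =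
      2 * V.card / ρ + (V.card : ℝ) ^ 2 / 2 := by field_simp
  have hVp : (0:ℝ) < V.card := lt_of_lt_of_le (by positivity) hVc
  have h3 : 2 * (V.card : ℝ) / ρ < (V.card : ℝ) ^ 2 / 2 := by
    rw [div_lt_iff₀ hρ]
    have : 4 < ρ * V.card := by nlinarith
    nlinarith
  linarith

def slo (p q : F × F) : F := (q.2 - p.2) / (q.1 - p.1)

def onl (X : Finset F) (p : F × F) (s : F) : Finset F := X.filter fun t => p.2 + s * (t - p.1) ∈ X

def Rel (X : Finset F) (θ : ℝ) (p q : F × F) : Prop :=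
  p.1 ≠ q.1 ∧ p.2 ≠ q.2 ∧ θ < ((onl X p (slo p q)).card : ℝ)

lemma line_fiber (X : Finset F) (θ : ℝ) (p q : F × F) (h : Rel X θ p q) :
    θ - 1 ≤ ((((X ×ˢ X).filter fun q' => Rel X θ p q').filter
      fun q' => slo p q' = slo p q).card : ℝ) := by
  obtain ⟨h1, h2, h3⟩ := h
  have hs0 : slo p q ≠ 0 := div_ne_zero (sub_ne_zero.2 h2.symm) (sub_ne_zero.2 h1.symm)
  have hc : ((onl X p (slo p q)).erase p.1).card ≤
      (((X ×ˢ X).filter fun q' => Rel X θ p q').filter fun q' => slo p q' = slo p q).card := by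
    apply Finset.card_le_card_of_injOn (fun t => (t, p.2 + slo p q * (t - p.1)))
    · intro t ht
      rw [Finset.mem_coe, Finset.mem_erase, onl, Finset.mem_filter] at ht
      obtain ⟨ht1, ht2, ht3⟩ := ht
      have hne : t - p.1 ≠ 0 := sub_ne_zero.2 ht1
      have hsl : slo p (t, p.2 + slo p q * (t - p.1)) = slo p q := by
        generalize slo p q = s
        simp only [slo]
        field_simp
        ring
      rw [Finset.mem_coe, Finset.mem_filter, Finset.mem_filter, Finset.mem_product]
      refine ⟨⟨⟨ht2, ht3⟩, ht1.symm, ?_, ?_⟩, hsl⟩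
      · simp only
        intro hh
        have : slo p q * (t - p.1) = 0 := by linear_combination -hh
        exact mul_ne_zero hs0 hne this
      · rw [hsl]; exact h3
    · intro t _ t' _ htt
      exact (Prod.ext_iff.1 htt).1
  have hc2 : (onl X p (slo p q)).card - 1 ≤ ((onl X p (slo p q)).erase p.1).card :=
    Finset.pred_card_le_card_erase
  have hc3 : (onl X p (slo p q)).card ≤ (((X ×ˢ X).filter fun q' => Rel X θ p q').filter
      fun q' => slo p q' = slo p q).card + 1 := by omega
  have hc4 : ((onl X p (slo p q)).card : ℝ) ≤ ((((X ×ˢ X).filter fun q' => Rel X θ p q').filter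
      fun q' => slo p q' = slo p q).card : ℝ) + 1 := by exact_mod_cast hc3
  linarith only [hc4, h3]

lemma sub_slopes (X : Finset F) (θ : ℝ) (p : F × F) (S3 : Finset F)
    (hS3 : S3 ⊆ ((X ×ˢ X).filter fun q => Rel X θ p q).image (slo p)) :
    (θ - 1) * S3.card ≤
      ((((X ×ˢ X).filter fun q => Rel X θ p q).filter fun q => slo p q ∈ S3).card : ℝ) := by
  apply fib_lower _ S3 (slo p)
  intro s hs
  obtain ⟨q, hq, rfl⟩ := Finset.mem_image.1 (hS3 hs)
  refine (line_fiber X θ p q (Finset.mem_filter.1 hq).2).trans (Nat.cast_le.2 ?_)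
  apply Finset.card_le_card
  intro q' hq'
  rw [Finset.mem_filter] at hq'
  rw [Finset.mem_filter, Finset.mem_filter]
  exact ⟨⟨hq'.1, hq'.2 ▸ hs⟩, hq'.2⟩

lemma ext_num1 (N K κ S T d d' e ρ : ℝ) (hN : 0 < N) (hK : 1 ≤ K) (hκ : 1 ≤ κ)
    (hρ : ρ = κ ^ 2 / (16 * K ^ 2)) (hS0 : 0 ≤ S) (hT0 : 0 ≤ T)
    (hS : N / (4 * κ) * S ≤ d) (hT : N / (4 * κ) * T ≤ d')
    (hd : ρ * N ^ 2 ≤ 2 * d) (hd' : ρ * N ^ 2 ≤ 2 * d') (he : d * d' ≤ 2 * N ^ 2 * e) :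
    128 * N ^ 2 * T ^ 2 * S ^ 2 ≤ (2 ^ 28 * K ^ 4) * e ^ 3 := by
  have hρp : 0 < ρ := by rw [hρ]; positivity
  have hdp : 0 < d := by nlinarith only [hd, show 0 < ρ * N ^ 2 by positivity]
  have hdp' : 0 < d' := by nlinarith only [hd', show 0 < ρ * N ^ 2 by positivity]
  have hS' : S ≤ 4 * κ * d / N := by
    rw [le_div_iff₀ hN]
    have : N / (4 * κ) * S = S * N / (4 * κ) := by ring
    rw [this, div_le_iff₀ (by positivity)] at hS
    linarith only [hS]
  have hT' : T ≤ 4 * κ * d' / N := by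
    rw [le_div_iff₀ hN]
    have : N / (4 * κ) * T = T * N / (4 * κ) := by ring
    rw [this, div_le_iff₀ (by positivity)] at hT
    linarith only [hT]
  have he1 : d * d' / (2 * N ^ 2) ≤ e := by
    rw [div_le_iff₀ (by positivity)]; linarith only [he]
  have hdd : (ρ * N ^ 2 / 2) * (ρ * N ^ 2 / 2) ≤ d * d' :=
    mul_le_mul (by linarith only [hd]) (by linarith only [hd']) (by positivity) hdp.le
  have s1 : 128 * N ^ 2 * T ^ 2 * S ^ 2 ≤
      128 * N ^ 2 * (4 * κ * d' / N) ^ 2 * (4 * κ * d / N) ^ 2 := by gcongr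
  have s2 : (2 ^ 28 * K ^ 4) * (d * d' / (2 * N ^ 2)) ^ 3 ≤ (2 ^ 28 * K ^ 4) * e ^ 3 := by gcongr
  refine s1.trans (le_trans ?_ s2)
  have s3 : (d * d' / (2 * N ^ 2)) ^ 3 = (d * d') ^ 2 * (d * d') / (8 * N ^ 6) := by
    field_simp; ring
  have s4 : (d * d') ^ 2 * ((ρ * N ^ 2 / 2) * (ρ * N ^ 2 / 2)) / (8 * N ^ 6) ≤
      (d * d' / (2 * N ^ 2)) ^ 3 := by
    rw [s3]
    apply div_le_div_of_nonneg_right _ (by positivity)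
    exact mul_le_mul_of_nonneg_left hdd (by positivity)
  refine le_trans (le_of_eq ?_) (mul_le_mul_of_nonneg_left s4 (by positivity))
  rw [hρ]
  field_simp
  ring

lemma ext_num2 (N K κ T d d' e a ρ : ℝ) (hN : 0 < N) (hK : 1 ≤ K) (hκ : 1 ≤ κ)
    (hρ : ρ = κ ^ 2 / (16 * K ^ 2)) (ha : 0 ≤ a)
    (hT : N / (4 * κ) * T ≤ d')
    (hd : ρ * N ^ 2 ≤ 2 * d) (hd' : ρ * N ^ 2 ≤ 2 * d') (he : d * d' ≤ 2 * N ^ 2 * e)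
    (hea : e ≤ 4 * T * a) : κ * N ≤ 1024 * K ^ 2 * a := by
  have hρp : 0 < ρ := by rw [hρ]; positivity
  have hdp' : 0 < d' := by nlinarith only [hd', show 0 < ρ * N ^ 2 by positivity]
  have hT' : T ≤ 4 * κ * d' / N := by
    rw [le_div_iff₀ hN]
    have : N / (4 * κ) * T = T * N / (4 * κ) := by ring
    rw [this, div_le_iff₀ (by positivity)] at hT
    linarith only [hT]
  have h1 : d * d' ≤ 2 * N ^ 2 * (4 * (4 * κ * d' / N) * a) := by
    refine he.trans (mul_le_mul_of_nonneg_left (hea.trans ?_) (by positivity))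
    exact mul_le_mul_of_nonneg_right (by linarith only [hT']) ha
  have h2 : 2 * N ^ 2 * (4 * (4 * κ * d' / N) * a) = (32 * N * κ * a) * d' := by
    field_simp; ring
  rw [h2] at h1
  have h3 := le_of_mul_le_mul_right h1 hdp'
  have h4 : ρ * N ^ 2 ≤ 64 * N * κ * a := by linarith only [h3, hd]
  rw [hρ] at h4
  have h5 : κ ^ 2 / (16 * K ^ 2) * N ^ 2 = (N * κ) * (κ * N) / (16 * K ^ 2) := by ring
  rw [h5, div_le_iff₀ (by positivity)] at h4
  have h6 : (N * κ) * (κ * N) ≤ (N * κ) * (1024 * K ^ 2 * a) := by linarith only [h4]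
  exact le_of_mul_le_mul_left h6 (by positivity)

lemma extract (X : Finset F) (N K κ : ℝ) (hN : N = X.card) (hK : 1 ≤ K) (hκ : 1 ≤ κ)
    (hκK : κ ≤ 4 * K) (hNK : 2 ^ 11 * K ^ 4 < N)
    (hcount : κ ^ 2 * N ^ 4 ≤ 16 * K ^ 2 *
      ((((X ×ˢ X) ×ˢ (X ×ˢ X)).filter fun w => Rel X (N / (2 * κ)) w.1 w.2).card : ℝ)) :
    ∃ A : Finset F, A.Nonempty ∧ (0:F) ∉ A ∧ (A.card : ℝ) ≤ N ∧ κ * N ≤ 1024 * K ^ 2 * A.card ∧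
      ((A - A).card : ℝ) ≤ (2 ^ 28 * K ^ 4) ^ 2 * A.card ∧
      ((A / A).card : ℝ) ≤ (2 ^ 28 * K ^ 4) ^ 2 * A.card ∧
      (∃ P ⊆ A ×ˢ A, (A.card : ℝ) ^ 2 ≤ 4 * P.card ∧
        ((P.image fun p => p.1 / p.2).card : ℝ) ≤ (2 ^ 28 * K ^ 4) * A.card) ∧
      ∃ p : F × F, ∀ S3 ⊆ A, N / (4 * κ) * S3.card ≤
        (((X ×ˢ X).filter fun q => p.1 ≠ q.1 ∧ slo p q ∈ S3).card : ℝ) := by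
  have hNp : 0 < N := lt_trans (by positivity) hNK
  have hKK : K ≤ K ^ 4 := le_self_pow₀ hK (by norm_num)
  have hN4 : 4 * κ ≤ N := by nlinarith only [hκK, hNK, hKK, hK]
  set ρ := κ ^ 2 / (16 * K ^ 2) with hρ
  have hρp : 0 < ρ := by rw [hρ]; positivity
  have hρN : 8 < ρ ^ 2 * N := by
    have h1 : 1 ≤ κ ^ 4 := one_le_pow₀ hκ
    have h2 : ρ ^ 2 * N = κ ^ 4 * N / (256 * K ^ 4) := by rw [hρ]; field_simp; ring
    rw [h2, lt_div_iff₀ (by positivity)]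
    nlinarith only [h1, hNK, hNp]
  have hcount' : ρ * N ^ 4 ≤
      ((((X ×ˢ X) ×ˢ (X ×ˢ X)).filter fun w => Rel X (N / (2 * κ)) w.1 w.2).card : ℝ) := by
    have : ρ * N ^ 4 = κ ^ 2 * N ^ 4 / (16 * K ^ 2) := by rw [hρ]; ring
    rw [this, div_le_iff₀ (by positivity)]
    linarith only [hcount]
  have hθ : N / (4 * κ) ≤ N / (2 * κ) - 1 := by
    have h1 : N / (2 * κ) = 2 * (N / (4 * κ)) := by field_simp; ring
    have h2 : 1 ≤ N / (4 * κ) := by rw [le_div_iff₀ (by positivity)]; linarith only [hN4]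
    linarith only [h1, h2]
  obtain ⟨u, hu, v, hv, v', hv', hvv, hd, hd', he⟩ :=
    pick_pair X (Rel X (N / (2 * κ))) N ρ hN hρp hρN hcount'
  set θ := N / (2 * κ) with hθdef
  set Q1 := (X ×ˢ X).filter fun q => Rel X θ (u, v) q with hQ1
  set Q2 := (X ×ˢ X).filter fun q => Rel X θ (u, v') q with hQ2
  set E := (X ×ˢ X).filter fun q => Rel X θ (u, v) q ∧ Rel X θ (u, v') q with hE
  set S := Q1.image (slo (u, v)) with hS
  set T := Q2.image (slo (u, v')) with hT
  have hSc : N / (4 * κ) * S.card ≤ Q1.card := by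
    refine le_trans (mul_le_mul_of_nonneg_right hθ (Nat.cast_nonneg _)) ?_
    refine (sub_slopes X θ (u, v) S (Finset.Subset.refl _)).trans (Nat.cast_le.2 ?_)
    exact Finset.card_filter_le _ _
  have hTc : N / (4 * κ) * T.card ≤ Q2.card := by
    refine le_trans (mul_le_mul_of_nonneg_right hθ (Nat.cast_nonneg _)) ?_
    refine (sub_slopes X θ (u, v') T (Finset.Subset.refl _)).trans (Nat.cast_le.2 ?_)
    exact Finset.card_filter_le _ _
  have hS0 : (0:F) ∉ S := by
    intro h
    obtain ⟨q, hq, hq0⟩ := Finset.mem_image.1 h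
    have hr := (Finset.mem_filter.1 hq).2
    exact div_ne_zero (sub_ne_zero.2 hr.2.1.symm) (sub_ne_zero.2 hr.1.symm) hq0
  have hT0 : (0:F) ∉ T := by
    intro h
    obtain ⟨q, hq, hq0⟩ := Finset.mem_image.1 h
    have hr := (Finset.mem_filter.1 hq).2
    exact div_ne_zero (sub_ne_zero.2 hr.2.1.symm) (sub_ne_zero.2 hr.1.symm) hq0
  set ψ : F × F → F × F := fun q => (slo (u, v) q, slo (u, v') q) with hψ
  have hEm : ∀ q ∈ E, q.1 ∈ X ∧ q.2 ∈ X ∧ q.1 - u ≠ 0 ∧ q.2 - v ≠ 0 ∧ q.2 - v' ≠ 0 := by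
    intro q hq
    rw [hE, Finset.mem_filter, Finset.mem_product] at hq
    exact ⟨hq.1.1, hq.1.2, sub_ne_zero.2 hq.2.1.1.symm, sub_ne_zero.2 hq.2.1.2.1.symm,
      sub_ne_zero.2 hq.2.2.2.1.symm⟩
  have hdiff : ∀ q ∈ E, (ψ q).1 - (ψ q).2 = (v' - v) / (q.1 - u) := by
    intro q hq
    obtain ⟨_, _, h3, h4, h5⟩ := hEm q hq
    simp only [hψ, slo]
    field_simp
    ring
  have hvv' : v' - v ≠ 0 := sub_ne_zero.2 hvv.symm
  have hinj : Set.InjOn ψ (E : Set (F × F)) := by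
    intro q hq q' hq' hqq
    have g1 := hdiff q hq
    have g2 := hdiff q' hq'
    obtain ⟨_, _, h3, h4, h5⟩ := hEm q hq
    obtain ⟨_, _, h3', h4', h5'⟩ := hEm q' hq'
    rw [hqq, g2] at g1
    have hx : q.1 = q'.1 := by
      rw [div_eq_div_iff h3' h3] at g1
      have := mul_left_cancel₀ hvv' g1
      linear_combination this
    have hs : slo (u, v) q = slo (u, v) q' := (Prod.ext_iff.1 hqq).1
    simp only [slo] at hs
    rw [hx, div_left_inj' h3'] at hs
    exact Prod.ext hx (by linear_combination hs)
  have hΓc : (E.image ψ).card = E.card := Finset.card_image_of_injOn hinj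
  have hN2 : (0:ℝ) < ρ * N ^ 2 := by positivity
  have hQ1p : (0:ℝ) < Q1.card := by linarith only [hd, hN2]
  have hQ2p : (0:ℝ) < Q2.card := by linarith only [hd', hN2]
  have hEp : (0:ℝ) < E.card := by
    have h1 : 0 < 2 * N ^ 2 * (E.card : ℝ) := lt_of_lt_of_le (mul_pos hQ1p hQ2p) he
    exact pos_of_mul_pos_right h1 (by positivity)
  have hEne : E.Nonempty := Finset.card_pos.1 (by exact_mod_cast hEp)
  obtain ⟨A, hAS, hAne, hAN, hAE, hAd, hAq, P, hP, hPc, hPr⟩ := drc S T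
    (X.image fun x => (v' - v) / (x - u)) (X.image fun y => (y - v) / (y - v')) hS0 hT0
    (E.image ψ) (by
      intro w hw
      obtain ⟨q, hq, rfl⟩ := Finset.mem_image.1 hw
      rw [hE, Finset.mem_filter] at hq
      refine Finset.mem_product.2 ⟨Finset.mem_image_of_mem _ ?_, Finset.mem_image_of_mem _ ?_⟩
      · exact Finset.mem_filter.2 ⟨hq.1, hq.2.1⟩
      · exact Finset.mem_filter.2 ⟨hq.1, hq.2.2⟩) N (2 ^ 28 * K ^ 4) (hEne.image _)
    (by rw [hN]; exact Nat.cast_le.2 Finset.card_image_le)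
    (by rw [hN]; exact Nat.cast_le.2 Finset.card_image_le)
    (by
      intro w hw
      obtain ⟨q, hq, rfl⟩ := Finset.mem_image.1 hw
      rw [hdiff q hq]
      exact Finset.mem_image_of_mem (fun x => (v' - v) / (x - u)) (hEm q hq).1)
    (by
      intro w hw
      obtain ⟨q, hq, rfl⟩ := Finset.mem_image.1 hw
      obtain ⟨_, h2, h3, h4, h5⟩ := hEm q hq
      refine Finset.mem_image.2 ⟨q.2, h2, ?_⟩
      simp only [hψ, slo]
      field_simp)
    (by
      rw [hΓc]
      exact ext_num1 N K κ S.card T.card Q1.card Q2.card E.card ρ hNp hK hκ hρ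
        (Nat.cast_nonneg _) (Nat.cast_nonneg _) hSc hTc hd hd' he)
  rw [hΓc] at hAE
  refine ⟨A, hAne, fun h => hS0 (hAS h), hAN, ?_, hAd, hAq, ⟨P, hP, hPc, hPr⟩, (u, v), ?_⟩
  · exact ext_num2 N K κ T.card Q1.card Q2.card E.card A.card ρ hNp hK hκ hρ
      (Nat.cast_nonneg _) hTc hd hd' he hAE
  · intro S3 hS3
    refine le_trans (mul_le_mul_of_nonneg_right hθ (Nat.cast_nonneg _)) ?_
    refine (sub_slopes X θ (u, v) S3 (hS3.trans hAS)).trans (Nat.cast_le.2 ?_)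
    apply Finset.card_le_card
    intro q hq
    rw [Finset.mem_filter, Finset.mem_filter] at hq
    exact Finset.mem_filter.2 ⟨hq.1.1, hq.1.2.1, hq.2⟩

def prs (X : Finset F) : Finset ((F × F) × (F × F)) :=
  ((X ×ˢ X) ×ˢ (X ×ˢ X)).filter fun w => w.1.1 ≠ w.2.1 ∧ w.1.2 ≠ w.2.2

def rsum (X : Finset F) : ℝ := ∑ w ∈ prs X, ((onl X w.1 (slo w.1 w.2)).card : ℝ)

lemma prs_card (X : Finset F) : ((prs X).card : ℝ) ≤ (X.card : ℝ) ^ 4 := by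
  have h : (prs X).card ≤ X.card ^ 4 := by
    refine (Finset.card_filter_le _ _).trans (le_of_eq ?_)
    simp only [Finset.card_product]
    ring
  exact_mod_cast h

lemma coset_pigeon (X : Finset F) (N : ℝ) (hN : N = X.card) (hNp : 0 < N) (G : Subfield F)
    (a0 : F) (ha0 : a0 ≠ 0) (p : F × F) (S3 : Finset F) (hS3 : ∀ s ∈ S3, s / a0 ∈ G) (t : ℝ)
    (ht : N * t ≤ (((X ×ˢ X).filter fun q => p.1 ≠ q.1 ∧ slo p q ∈ S3).card : ℝ)) :
    ∃ c d : F, t ≤ ((X.filter fun x => ∃ g ∈ G, x = c * g + d).card : ℝ) := by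
  have hX : X.Nonempty := by
    rw [← Finset.card_pos]
    rw [hN] at hNp
    exact_mod_cast hNp
  set W := (X ×ˢ X).filter fun q => p.1 ≠ q.1 ∧ slo p q ∈ S3 with hW
  obtain ⟨x, hx, hpig⟩ := fib_pigeon W X (fun q => q.1) hX (fun q hq => by
    rw [hW, Finset.mem_filter, Finset.mem_product] at hq
    exact hq.1.1)
  refine ⟨(x - p.1) * a0, p.2, ?_⟩
  have h1 : (W.filter fun q => q.1 = x).card ≤
      (X.filter fun y => ∃ g ∈ G, y = ((x - p.1) * a0) * g + p.2).card := by
    apply Finset.card_le_card_of_injOn (fun q => q.2)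
    · intro q hq
      rw [Finset.mem_coe, Finset.mem_filter, hW, Finset.mem_filter, Finset.mem_product] at hq
      obtain ⟨⟨⟨q1, q2⟩, q3, q4⟩, rfl⟩ := hq
      rw [Finset.mem_coe, Finset.mem_filter]
      refine ⟨q2, slo p q / a0, hS3 _ q4, ?_⟩
      have : q.1 - p.1 ≠ 0 := sub_ne_zero.2 q3.symm
      simp only [slo]
      field_simp
      ring
    · intro q hq q' hq' hqq
      rw [Finset.mem_coe, Finset.mem_filter] at hq hq'
      exact Prod.ext (hq.2.trans hq'.2.symm) hqq
  rw [← hN] at hpig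
  have h2 : N * t ≤ N * ((W.filter fun q => q.1 = x).card : ℝ) := by linarith only [hpig, ht]
  exact (le_of_mul_le_mul_left h2 hNp).trans (Nat.cast_le.2 h1)

lemma rpow_case (N C c K : ℝ) (hN : 0 < N) (h : N ≤ c * K ^ 2 * (C * N ^ ((51:ℝ)/52)))
    (hc : 0 < c) (hC : 0 < C) (hK : 1 ≤ K) :
    N ≤ (c * C) ^ 52 * K ^ 104 := by
  have h1 : N = N ^ ((1:ℝ)/52) * N ^ ((51:ℝ)/52) := by
    rw [← Real.rpow_add hN]; norm_num
  have hp : 0 < N ^ ((51:ℝ)/52) := Real.rpow_pos_of_pos hN _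
  have h2 : N ^ ((1:ℝ)/52) * N ^ ((51:ℝ)/52) ≤ (c * C * K ^ 2) * N ^ ((51:ℝ)/52) := by
    rw [← h1]; linarith only [h]
  have h3 := le_of_mul_le_mul_right h2 hp
  have h4 : (N ^ ((1:ℝ)/52)) ^ 52 ≤ (c * C * K ^ 2) ^ 52 :=
    pow_le_pow_left₀ (Real.rpow_nonneg hN.le _) h3 52
  rw [← Real.rpow_natCast, ← Real.rpow_mul hN.le] at h4
  norm_num at h4
  refine h4.trans (le_of_eq (by ring))

lemma sqrt_case (N C c K g b : ℝ) (hN : 0 < N) (hg : 0 ≤ g)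
    (h : N ≤ c * K ^ 2 * (C * g ^ ((1:ℝ)/2)))
    (hgb : g ≤ b * K ^ 80 * N) :
    N ≤ (c * C) ^ 2 * b * K ^ 84 := by
  have h1 : N ^ 2 ≤ (c * K ^ 2 * (C * g ^ ((1:ℝ)/2))) ^ 2 := pow_le_pow_left₀ hN.le h 2
  have h2 : (g ^ ((1:ℝ)/2)) ^ 2 = g := by
    rw [← Real.rpow_natCast, ← Real.rpow_mul hg]; norm_num
  have h3 : (c * K ^ 2 * (C * g ^ ((1:ℝ)/2))) ^ 2 = (c * C) ^ 2 * K ^ 4 * g := by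
    calc _ = (c * C) ^ 2 * K ^ 4 * (g ^ ((1:ℝ)/2)) ^ 2 := by
          generalize g ^ ((1:ℝ)/2) = z
          ring
      _ = _ := by rw [h2]
  rw [h3] at h1
  have h4 : (c * C) ^ 2 * K ^ 4 * g ≤ (c * C) ^ 2 * K ^ 4 * (b * K ^ 80 * N) :=
    mul_le_mul_of_nonneg_left hgb (by positivity)
  have h5 : N * N ≤ ((c * C) ^ 2 * b * K ^ 84) * N := by nlinarith only [h1, h4]
  exact le_of_mul_le_mul_right h5 hN

lemma main_lemma (C : ℝ) (hC : 0 < C) : ∃ C0 : ℝ, 1 ≤ C0 ∧ ∀ (F : Type) [Field F] [Fintype F]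
    (X : Finset F) (K : ℝ), 1 ≤ K → X.Nonempty →
    subfieldCond X C ((X.card : ℝ) ^ ((51:ℝ)/52)) → (X.card : ℝ) ^ 5 / K ≤ rsum X →
    (X.card : ℝ) ≤ C0 * K ^ 104 ∨ (Fintype.card F : ℝ) ≤ C0 * K ^ 95 * X.card := by
  obtain ⟨h, hh⟩ : ∃ h : ℝ, h = 2 ^ 28 := ⟨_, rfl⟩
  obtain ⟨c1, hc1⟩ : ∃ h : ℝ, h = 10 * 8 ^ 4 * 32 ^ 7 := ⟨_, rfl⟩
  obtain ⟨c2, hc2⟩ : ∃ h : ℝ, h = 7 * 8 ^ 4 * 32 ^ 4 := ⟨_, rfl⟩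
  have hp : 1 ≤ h := by rw [hh]; norm_num
  have hc1p : 0 < c1 := by rw [hc1]; norm_num
  have hc2p : 0 < c2 := by rw [hc2]; norm_num
  obtain ⟨d1, hd1⟩ : ∃ d : ℝ, d = 1024 * c1 * h ^ 25 := ⟨_, rfl⟩
  obtain ⟨d2, hd2⟩ : ∃ d : ℝ, d = c2 * h ^ 20 := ⟨_, rfl⟩
  obtain ⟨d3, hd3⟩ : ∃ d : ℝ, d = 1024 * (2 * 32 ^ 2) * h ^ 6 := ⟨_, rfl⟩
  obtain ⟨d4, hd4⟩ : ∃ d : ℝ, d = (8192 * C) ^ 52 := ⟨_, rfl⟩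
  obtain ⟨d5, hd5⟩ : ∃ d : ℝ, d = (8192 * C) ^ 2 * d2 := ⟨_, rfl⟩
  have hd1p : 0 ≤ d1 := by rw [hd1]; positivity
  have hd2p : 0 ≤ d2 := by rw [hd2]; positivity
  have hd3p : 0 ≤ d3 := by rw [hd3]; positivity
  have hd4p : 0 ≤ d4 := by rw [hd4]; positivity
  have hd5p : 0 ≤ d5 := by rw [hd5]; positivity
  refine ⟨2 ^ 11 + d1 + d2 + d3 + d4 + d5, by linarith, ?_⟩
  intro F _ _ X K hK hXne hsub hsum
  set C0 := 2 ^ 11 + d1 + d2 + d3 + d4 + d5 with hC0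
  obtain ⟨N, hN⟩ : ∃ N : ℝ, N = X.card := ⟨_, rfl⟩
  rw [← hN] at hsum hsub ⊢
  have hNp : 0 < N := by rw [hN]; exact_mod_cast hXne.card_pos
  by_contra! hcon
  obtain ⟨hcon1, hcon2⟩ := hcon
  have hbig : ∀ (c : ℝ) (a : ℕ), 0 ≤ c → c ≤ C0 → a ≤ 104 → c * K ^ a < N := by
    intro c a h0 h1 h2
    refine lt_of_le_of_lt ?_ hcon1
    exact mul_le_mul h1 (pow_le_pow_right₀ hK h2) (by positivity) (h0.trans h1)
  obtain ⟨κ, hκ, hκK, hcount⟩ := dyadic (prs X) (fun w => ((onl X w.1 (slo w.1 w.2)).card : ℝ))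
    N K hNp hK (fun w _ => by rw [hN]; exact Nat.cast_le.2 (Finset.card_filter_le _ _))
    (by rw [hN]; exact prs_card X) hsum
  have hcount' : κ ^ 2 * N ^ 4 ≤ 16 * K ^ 2 *
      ((((X ×ˢ X) ×ˢ (X ×ˢ X)).filter fun w => Rel X (N / (2 * κ)) w.1 w.2).card : ℝ) := by
    refine hcount.trans (mul_le_mul_of_nonneg_left (Nat.cast_le.2 (Finset.card_le_card ?_))
      (by positivity))
    intro w hw
    rw [Finset.mem_filter, prs, Finset.mem_filter] at hw
    exact Finset.mem_filter.2 ⟨hw.1.1, hw.1.2.1, hw.1.2.2, hw.2⟩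
  obtain ⟨A, hAne, hA0, hAN, hAκ, hAd, hAq, ⟨P, hP, hPc, hPr⟩, p, hp3⟩ :=
    extract X N K κ hN hK hκ hκK
      (hbig _ 4 (by norm_num) (by linarith only [hC0, hd1p, hd2p, hd3p, hd4p, hd5p]) (by norm_num))
      hcount'
  rw [← hh] at hAd hAq hPr
  have hAp : (0:ℝ) < A.card := by exact_mod_cast hAne.card_pos
  have hNA : N ≤ 1024 * K ^ 2 * A.card := le_trans (by nlinarith only [hκ, hNp]) hAκ
  have hH1 : 1 ≤ h * K ^ 4 := one_le_mul_of_one_le_of_one_le hp (one_le_pow₀ hK)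
  rcases pivot_wrap A hAne hA0 (h * K ^ 4) hH1 hAd hAq P hP hPc hPr with
    hsmall | ⟨G, a0, ha0, hG1, hG2⟩
  · rw [← hc1] at hsmall
    have := hbig d1 102 hd1p (by linarith only [hC0, hd1p, hd2p, hd3p, hd4p, hd5p]) (by norm_num)
    have h2 : 1024 * K ^ 2 * A.card ≤ 1024 * K ^ 2 * (c1 * (h * K ^ 4) ^ 25) :=
      mul_le_mul_of_nonneg_left hsmall (by positivity)
    have h3 : 1024 * K ^ 2 * (c1 * (h * K ^ 4) ^ 25) = d1 * K ^ 102 := by rw [hd1]; ring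
    linarith only [this, h2, h3, hNA]
  rw [← hc2] at hG1
  have hG3 : (Nat.card G : ℝ) ≤ d2 * K ^ 80 * N := by
    refine hG1.trans ?_
    have : c2 * (h * K ^ 4) ^ 20 = d2 * K ^ 80 := by rw [hd2]; ring
    rw [this]
    exact mul_le_mul_of_nonneg_left hAN (by positivity)
  by_cases hGt : G = ⊤
  · subst hGt
    have h1 : (Nat.card (⊤ : Subfield F) : ℝ) = Fintype.card F := by
      rw [Nat.card_congr (Subfield.topEquiv (K := F)).toEquiv, Nat.card_eq_fintype_card]
    rw [h1] at hG3
    have h2 : d2 * K ^ 80 ≤ C0 * K ^ 95 :=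
      mul_le_mul (by linarith only [hC0, hd1p, hd2p, hd3p, hd4p, hd5p])
        (pow_le_pow_right₀ hK (by norm_num)) (by positivity)
        (by linarith only [hC0, hd1p, hd2p, hd3p, hd4p, hd5p])
    have h3 := mul_le_mul_of_nonneg_right h2 hNp.le
    linarith only [h3, hG3, hcon2]
  have hA2 : 2 * (32 ^ 2 * (h * K ^ 4) ^ 6) ≤ A.card := by
    by_contra! hlt
    have := hbig d3 26 hd3p (by linarith only [hC0, hd1p, hd2p, hd3p, hd4p, hd5p]) (by norm_num)
    have h2 : 1024 * K ^ 2 * A.card ≤ 1024 * K ^ 2 * (2 * (32 ^ 2 * (h * K ^ 4) ^ 6)) :=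
      mul_le_mul_of_nonneg_left hlt.le (by positivity)
    have h3 : 1024 * K ^ 2 * (2 * (32 ^ 2 * (h * K ^ 4) ^ 6)) = d3 * K ^ 26 := by rw [hd3]; ring
    linarith only [this, h2, h3, hNA]
  have hS3 : (A.card : ℝ) ≤ 2 * (A.filter fun x => x / a0 ∈ G).card := by
    have h1 := Finset.card_filter_add_card_filter_not (s := A) (fun x => x / a0 ∈ G)
    have h2 : ((A.filter fun x => x / a0 ∈ G).card : ℝ) +
      ((A.filter fun x => x / a0 ∉ G).card : ℝ) = A.card := by exact_mod_cast h1
    linarith only [h2, hG2, hA2]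
  obtain ⟨c, d, hcd⟩ := coset_pigeon X N hN hNp G a0 ha0 p (A.filter fun x => x / a0 ∈ G)
    (fun s hs => (Finset.mem_filter.1 hs).2) (A.card / (8 * κ)) (by
      refine le_trans ?_ (hp3 _ (Finset.filter_subset _ _))
      have h1 : N * ((A.card : ℝ) / (8 * κ)) = N / (4 * κ) * (A.card / 2) := by
        field_simp; ring
      rw [h1]
      exact mul_le_mul_of_nonneg_left (by linarith only [hS3]) (by positivity))
  have hfin := hcd.trans (hsub G hGt c d)
  have hNf : N ≤ 8192 * K ^ 2 * (C * max ((Nat.card G : ℝ) ^ ((1:ℝ)/2)) (N ^ ((51:ℝ)/52))) := by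
    refine le_trans ?_ (mul_le_mul_of_nonneg_left hfin (by positivity))
    have h1 : 8192 * K ^ 2 * ((A.card : ℝ) / (8 * κ)) = 1024 * K ^ 2 * A.card / κ := by
      field_simp; ring
    rw [h1, le_div_iff₀ (by positivity)]
    linarith only [hAκ]
  rcases max_cases ((Nat.card G : ℝ) ^ ((1:ℝ)/2)) (N ^ ((51:ℝ)/52)) with ⟨hm, _⟩ | ⟨hm, _⟩
  · rw [hm] at hNf
    have h1 := sqrt_case N C 8192 K (Nat.card G) d2 hNp (Nat.cast_nonneg _) hNf hG3
    rw [← hd5] at h1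
    have := hbig d5 84 hd5p (by linarith only [hC0, hd1p, hd2p, hd3p, hd4p, hd5p]) (by norm_num)
    linarith only [h1, this]
  · rw [hm] at hNf
    have h1 := rpow_case N C 8192 K hNp hNf (by norm_num) hC hK
    rw [← hd4] at h1
    have := hbig d4 104 hd4p (by linarith only [hC0, hd1p, hd2p, hd3p, hd4p, hd5p]) (by norm_num)
    linarith only [h1, this]

def fl (X : Finset F) (m z : F) : ℕ := (X.filter fun t => m * t + z ∈ X).card

def slp (i : F × F) : F := (i.1 / i.2) ^ 2

def icp (i : F × F) : F := (i.2 - i.1) / i.2 ^ 2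

lemma energy_le (A B : Finset F) (hA : (0:F) ∉ A) (hB : (0:F) ∉ B) (hAB : (0:F) ∉ A + B) :
    addEnergy A⁻¹ B⁻¹ ≤ ∑ i ∈ B ×ˢ B, fl (A + B)⁻¹ (slp i) (icp i) := by
  have h1 : addEnergy A⁻¹ B⁻¹ ≤ ((B ×ˢ B).sigma fun i =>
      (A + B)⁻¹.filter fun t => slp i * t + icp i ∈ (A + B)⁻¹).card := by
    apply Finset.card_le_card_of_injOn
      (fun w => ⟨(w.2.1⁻¹, w.2.2⁻¹), (w.1.1⁻¹ + w.2.1⁻¹)⁻¹⟩)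
    · intro w hw
      rw [Finset.mem_coe, Finset.mem_filter, Finset.mem_product, Finset.mem_product,
        Finset.mem_product] at hw
      obtain ⟨⟨⟨x1, x2⟩, y1, y2⟩, he⟩ := hw
      rw [Finset.mem_inv'] at x1 x2 y1 y2
      have s1 := Finset.add_mem_add x1 y1
      have s2 := Finset.add_mem_add x2 y2
      have n1 : w.1.1⁻¹ + w.2.1⁻¹ ≠ 0 := fun h => hAB (h ▸ s1)
      have n2 : w.1.2⁻¹ + w.2.2⁻¹ ≠ 0 := fun h => hAB (h ▸ s2)
      have m1 : w.1.1 ≠ 0 := fun h => hA (by rwa [h, inv_zero] at x1)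
      have m2 : w.1.2 ≠ 0 := fun h => hA (by rwa [h, inv_zero] at x2)
      have m3 : w.2.1 ≠ 0 := fun h => hB (by rwa [h, inv_zero] at y1)
      have m4 : w.2.2 ≠ 0 := fun h => hB (by rwa [h, inv_zero] at y2)
      have t2 : slp (w.2.1⁻¹, w.2.2⁻¹) * (w.1.1⁻¹ + w.2.1⁻¹)⁻¹ + icp (w.2.1⁻¹, w.2.2⁻¹) =
          (w.1.2⁻¹ + w.2.2⁻¹)⁻¹ := by
        simp only [slp, icp]
        have k1 : w.1.1 = w.1.2 + w.2.2 - w.2.1 := by linear_combination he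
        have e1 : (w.1.1⁻¹ + w.2.1⁻¹) = (w.1.1 + w.2.1) / (w.1.1 * w.2.1) := by field_simp; ring
        have e2 : (w.1.2⁻¹ + w.2.2⁻¹) = (w.1.2 + w.2.2) / (w.1.2 * w.2.2) := by field_simp; ring
        rw [e1] at n1 ⊢
        rw [e2] at n2 ⊢
        have k2 : w.1.1 + w.2.1 ≠ 0 := fun h => n1 (by rw [h, zero_div])
        have k3 : w.1.2 + w.2.2 ≠ 0 := fun h => n2 (by rw [h, zero_div])
        generalize w.1.1 = a at *
        generalize w.1.2 = a' at *
        generalize w.2.1 = c at *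
        generalize w.2.2 = c' at *
        rw [he]
        subst k1
        field_simp
        ring
      simp only [Finset.coe_sigma, Set.mem_sigma_iff, Finset.mem_coe, Finset.mem_filter,
        Finset.mem_product]
      refine ⟨⟨y1, y2⟩, Finset.inv_mem_inv s1, ?_⟩
      rw [t2]
      exact Finset.inv_mem_inv s2
    · intro w hw w' hw' hww
      rw [Finset.mem_coe, Finset.mem_filter] at hw hw'
      simp only [Sigma.mk.injEq, heq_eq_eq, Prod.mk.injEq, inv_inj] at hww
      obtain ⟨⟨g1, g2⟩, g3⟩ := hww
      rw [g1] at g3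
      have g4 : w.1.1 = w'.1.1 := inv_injective (add_right_cancel g3)
      have g5 : w.1.2 = w'.1.2 := by
        linear_combination g4 + g1 - g2 - hw.2 + hw'.2
      exact Prod.ext (Prod.ext g4 g5) (Prod.ext g1 g2)
  rw [Finset.card_sigma] at h1
  exact h1

/-- pairs of points of the grid on the line with slope m and intercept z -/
def lpr (X : Finset F) (m z : F) : Finset ((F × F) × (F × F)) :=
  (prs X).filter fun w => w.1.2 = m * w.1.1 + z ∧ w.2.2 = m * w.2.1 + z

lemma onl_eq (X : Finset F) (m z : F) (w : (F × F) × (F × F)) (hw : w ∈ lpr X m z) :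
    slo w.1 w.2 = m ∧ (onl X w.1 (slo w.1 w.2)).card = fl X m z := by
  rw [lpr, Finset.mem_filter, prs, Finset.mem_filter] at hw
  obtain ⟨⟨_, h1, _⟩, h2, h3⟩ := hw
  have h4 : w.2.1 - w.1.1 ≠ 0 := sub_ne_zero.2 h1.symm
  have h5 : slo w.1 w.2 = m := by
    simp only [slo]
    rw [div_eq_iff h4, h2, h3]
    ring
  refine ⟨h5, ?_⟩
  rw [h5, onl, fl]
  congr 1
  apply Finset.filter_congr
  intro t _
  have : w.1.2 + m * (t - w.1.1) = m * t + z := by rw [h2]; ring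
  rw [this]

lemma lpr_card (X : Finset F) (m z : F) (hm : m ≠ 0) :
    fl X m z * (fl X m z - 1) ≤ (lpr X m z).card := by
  have h1 := Finset.offDiag_card (X.filter fun t => m * t + z ∈ X)
  rw [show fl X m z * (fl X m z - 1) = ((X.filter fun t => m * t + z ∈ X).offDiag).card by
    rw [h1, fl, Nat.mul_sub, mul_one]]
  apply Finset.card_le_card_of_injOn (fun p => ((p.1, m * p.1 + z), (p.2, m * p.2 + z)))
  · intro p hp
    rw [Finset.mem_coe, Finset.mem_offDiag, Finset.mem_filter, Finset.mem_filter] at hp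
    obtain ⟨p1, p2, p3⟩ := hp
    rw [Finset.mem_coe, lpr, Finset.mem_filter, prs, Finset.mem_filter]
    simp only [Finset.mem_product]
    refine ⟨⟨⟨p1, p2⟩, p3, ?_⟩, trivial, trivial⟩
    intro h
    exact p3 (mul_left_cancel₀ hm (add_right_cancel h))
  · intro p _ p' _ h
    simp only [Prod.mk.injEq] at h
    exact Prod.ext h.1.1 h.2.1

lemma two_lines (X B : Finset F) (hB : (0:F) ∉ B) (w : (F × F) × (F × F)) :
    (((B ×ˢ B).filter fun i => i.1 ≠ i.2 ∧ w ∈ lpr X (slp i) (icp i)).card) ≤ 2 := by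
  set I := (B ×ˢ B).filter fun i => i.1 ≠ i.2 ∧ w ∈ lpr X (slp i) (icp i) with hI
  rcases I.eq_empty_or_nonempty with h | ⟨i0, hi0⟩
  · rw [h]; simp
  have hm : ∀ i ∈ I, i.1 ≠ 0 ∧ i.2 ≠ 0 ∧ i.1 ≠ i.2 ∧ slo w.1 w.2 = slp i ∧
      w.1.2 = slp i * w.1.1 + icp i := by
    intro i hi
    rw [hI, Finset.mem_filter, Finset.mem_product] at hi
    refine ⟨fun h => hB (h ▸ hi.1.1), fun h => hB (h ▸ hi.1.2), hi.2.1, (onl_eq _ _ _ _ hi.2.2).1, ?_⟩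
    have := hi.2.2
    rw [lpr, Finset.mem_filter] at this
    exact this.2.1
  obtain ⟨a1, a2, a3, a4, a5⟩ := hm i0 hi0
  have : I.card ≤ ({i0.1 / i0.2, -(i0.1 / i0.2)} : Finset F).card := by
    apply Finset.card_le_card_of_injOn (fun i => i.1 / i.2)
    · intro i hi
      obtain ⟨b1, b2, b3, b4, b5⟩ := hm i hi
      rw [a4] at b4
      simp only [slp] at b4
      rcases sq_eq_sq_iff_eq_or_eq_neg.1 b4.symm with h | h <;> simp [h]
    · intro i hi j hj hij
      obtain ⟨b1, b2, b3, b4, b5⟩ := hm i hi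
      obtain ⟨c1, c2, c3, c4, c5⟩ := hm j hj
      have k1 : icp i = icp j := by
        have : slp i = slp j := b4.symm.trans c4
        rw [this] at b5
        linear_combination c5 - b5
      simp only at hij
      have k2 : icp i = (1 - i.1 / i.2) / i.2 := by simp only [icp]; field_simp
      have k3 : icp j = (1 - j.1 / j.2) / j.2 := by simp only [icp]; field_simp
      rw [k2, k3, hij] at k1
      have k4 : 1 - j.1 / j.2 ≠ 0 := by
        intro h
        apply c3
        field_simp at h
        linear_combination -h
      have k5 : i.2 = j.2 := by
        rw [div_eq_div_iff b2 c2] at k1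
        exact (mul_left_cancel₀ k4 k1).symm
      rw [k5, div_left_inj' c2] at hij
      exact Prod.ext hij k5
  exact this.trans Finset.card_le_two

lemma reduce (X B : Finset F) (hB : (0:F) ∉ B) :
    ∃ S : ℝ, 0 ≤ S ∧ S ^ 3 ≤ 4 * (B.card : ℝ) ^ 4 * rsum X ∧
      ((∑ i ∈ B ×ˢ B, fl X (slp i) (icp i) : ℕ) : ℝ) ≤
        B.card * X.card + (B.card : ℝ) ^ 2 + S := by
  set f : F × F → ℕ := fun i => fl X (slp i) (icp i) with hf
  set I := (B ×ˢ B).filter fun i => i.1 ≠ i.2 ∧ 2 ≤ f i with hI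
  have hB2 : (((B ×ˢ B).card : ℕ) : ℝ) = (B.card : ℝ) ^ 2 := by
    rw [Finset.card_product]; push_cast; ring
  have hr0 : 0 ≤ rsum X := Finset.sum_nonneg (fun _ _ => Nat.cast_nonneg _)
  refine ⟨∑ i ∈ I, (f i : ℝ), Finset.sum_nonneg (fun _ _ => Nat.cast_nonneg _), ?_, ?_⟩
  · have hcube : ∑ i ∈ I, (f i : ℝ) ^ 3 ≤ 4 * rsum X := by
      have h1 : ∀ i ∈ I, (f i : ℝ) ^ 3 ≤ 2 * ∑ w ∈ prs X,
          (if w ∈ lpr X (slp i) (icp i) then ((onl X w.1 (slo w.1 w.2)).card : ℝ) else 0) := by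
        intro i hi
        rw [hI, Finset.mem_filter, Finset.mem_product] at hi
        have n1 : i.1 ≠ 0 := fun h => hB (h ▸ hi.1.1)
        have n2 : i.2 ≠ 0 := fun h => hB (h ▸ hi.1.2)
        have hm : slp i ≠ 0 := pow_ne_zero _ (div_ne_zero n1 n2)
        have hc := lpr_card X (slp i) (icp i) hm
        have hsum : ∑ w ∈ prs X,
            (if w ∈ lpr X (slp i) (icp i) then ((onl X w.1 (slo w.1 w.2)).card : ℝ) else 0) =
            ∑ w ∈ lpr X (slp i) (icp i), (f i : ℝ) := by
          rw [← Finset.sum_filter]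
          have : (prs X).filter (fun w => w ∈ lpr X (slp i) (icp i)) = lpr X (slp i) (icp i) := by
            ext w
            rw [Finset.mem_filter]
            exact ⟨fun h => h.2, fun h => ⟨(Finset.mem_filter.1 h).1, h⟩⟩
          rw [this]
          apply Finset.sum_congr rfl
          intro w hw
          rw [(onl_eq X _ _ w hw).2]
        rw [hsum, Finset.sum_const, nsmul_eq_mul]
        have h2 : 2 ≤ f i := hi.2.2
        have hc' : (f i : ℝ) * (f i - 1) ≤ (lpr X (slp i) (icp i)).card := by
          have : ((f i * (f i - 1) : ℕ) : ℝ) ≤ (lpr X (slp i) (icp i)).card := Nat.cast_le.2 hc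
          rw [Nat.cast_mul, Nat.cast_sub (by omega)] at this
          exact_mod_cast this
        have h2' : (2:ℝ) ≤ f i := by exact_mod_cast h2
        have h3 : (f i : ℝ) * (f i * (f i - 1)) ≤ f i * (lpr X (slp i) (icp i)).card :=
          mul_le_mul_of_nonneg_left hc' (Nat.cast_nonneg _)
        nlinarith only [h3, h2', mul_nonneg (sq_nonneg (f i : ℝ)) (sub_nonneg.2 h2')]
      refine (Finset.sum_le_sum h1).trans ?_
      rw [← Finset.mul_sum, Finset.sum_comm]
      have h2 : ∑ w ∈ prs X, ∑ i ∈ I,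
          (if w ∈ lpr X (slp i) (icp i) then ((onl X w.1 (slo w.1 w.2)).card : ℝ) else 0) ≤
          ∑ w ∈ prs X, 2 * ((onl X w.1 (slo w.1 w.2)).card : ℝ) := by
        apply Finset.sum_le_sum
        intro w _
        rw [← Finset.sum_filter, Finset.sum_const, nsmul_eq_mul]
        apply mul_le_mul_of_nonneg_right _ (Nat.cast_nonneg _)
        have : (I.filter fun i => w ∈ lpr X (slp i) (icp i)).card ≤ 2 := by
          refine (Finset.card_le_card ?_).trans (two_lines X B hB w)
          intro i hi
          rw [Finset.mem_filter, hI, Finset.mem_filter] at hi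
          exact Finset.mem_filter.2 ⟨hi.1.1, hi.1.2.1, hi.2⟩
        exact_mod_cast this
      rw [← Finset.mul_sum] at h2
      have h3 : ∑ w ∈ prs X, ((onl X w.1 (slo w.1 w.2)).card : ℝ) = rsum X := rfl
      rw [h3] at h2
      linarith only [h2]
    have hIc : (I.card : ℝ) ≤ (B.card : ℝ) ^ 2 := by
      rw [← hB2]
      exact Nat.cast_le.2 (Finset.card_filter_le _ _)
    have hpm := pow_sum_div_card_le_sum_pow (s := I) (f := fun i => (f i : ℝ))
      (fun _ _ => Nat.cast_nonneg _) 2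
    rcases I.eq_empty_or_nonempty with hIe | hIne
    · rw [hIe, Finset.sum_empty, zero_pow (by norm_num)]
      positivity
    have hIp : (0:ℝ) < I.card := by exact_mod_cast hIne.card_pos
    rw [div_le_iff₀ (by positivity)] at hpm
    refine hpm.trans ?_
    calc _ ≤ (4 * rsum X) * ((B.card : ℝ) ^ 2) ^ 2 :=
          mul_le_mul hcube (pow_le_pow_left₀ hIp.le hIc 2) (by positivity) (by positivity)
      _ = _ := by ring
  · have h1 : ∀ i ∈ B ×ˢ B, (f i : ℝ) ≤ (if i.1 = i.2 then (X.card : ℝ) else 0) + 1 +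
        (if i.1 ≠ i.2 ∧ 2 ≤ f i then (f i : ℝ) else 0) := by
      intro i hi
      have hle : (f i : ℝ) ≤ X.card := Nat.cast_le.2 (Finset.card_filter_le _ _)
      by_cases h : i.1 = i.2
      · rw [if_pos h, if_neg (by tauto)]
        linarith
      · by_cases h2 : 2 ≤ f i
        · rw [if_neg h, if_pos ⟨h, h2⟩]
          linarith
        · rw [if_neg h, if_neg (by tauto)]
          have : f i ≤ 1 := by omega
          have : (f i : ℝ) ≤ 1 := by exact_mod_cast this
          linarith
    rw [Nat.cast_sum]
    refine (Finset.sum_le_sum h1).trans ?_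
    rw [Finset.sum_add_distrib, Finset.sum_add_distrib]
    have h2 : ∑ i ∈ B ×ˢ B, (if i.1 ≠ i.2 ∧ 2 ≤ f i then (f i : ℝ) else 0) = ∑ i ∈ I, (f i : ℝ) := by
      rw [← Finset.sum_filter]
    have h3 : ∑ i ∈ B ×ˢ B, (1:ℝ) = (B.card : ℝ) ^ 2 := by
      rw [Finset.sum_const, nsmul_eq_mul, hB2, mul_one]
    have h4 : ∑ i ∈ B ×ˢ B, (if i.1 = i.2 then (X.card : ℝ) else 0) = B.card * X.card := by
      rw [Finset.sum_product]
      simp [Finset.sum_ite_eq]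
    rw [h2, h3, h4]

lemma rsum_bound (C : ℝ) (hC : 0 < C) : ∃ C0 : ℝ, 1 ≤ C0 ∧ ∀ (F : Type) [Field F] [Fintype F]
    (X : Finset F), X.Nonempty → subfieldCond X C ((X.card : ℝ) ^ ((51:ℝ)/52)) →
    rsum X ≤ C0 * (((X.card : ℝ) ^ ((173:ℝ)/104)) ^ 3 +
      ((Fintype.card F : ℝ) ^ (-(1:ℝ)/285) * (X.card : ℝ) ^ ((476:ℝ)/285)) ^ 3) := by
  obtain ⟨C0, hC0, hmain⟩ := main_lemma C hC
  refine ⟨C0, hC0, ?_⟩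
  intro F _ _ X hX hsub
  have hNp : (0:ℝ) < X.card := by exact_mod_cast hX.card_pos
  have hqp : (0:ℝ) < Fintype.card F := by exact_mod_cast Fintype.card_pos
  have hr0 : 0 ≤ rsum X := Finset.sum_nonneg (fun _ _ => Nat.cast_nonneg _)
  rcases hr0.eq_or_lt with h0 | hpos
  · rw [← h0]; positivity
  have hr5 : rsum X ≤ (X.card : ℝ) ^ 5 := by
    have h1 : rsum X ≤ (prs X).card • (X.card : ℝ) :=
      Finset.sum_le_card_nsmul _ _ _ (fun w _ => Nat.cast_le.2 (Finset.card_filter_le _ _))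
    rw [nsmul_eq_mul] at h1
    have h2 := mul_le_mul_of_nonneg_right (prs_card X) hNp.le
    refine h1.trans (h2.trans (le_of_eq (by ring)))
  have hK : 1 ≤ (X.card : ℝ) ^ 5 / rsum X := by rw [one_le_div hpos]; exact hr5
  have hm := hmain F X _ hK hX hsub (by rw [div_div_cancel₀ (by positivity)])
  clear hmain hsub hK
  generalize rsum X = r at *
  generalize (X.card : ℝ) = N at *
  generalize (Fintype.card F : ℝ) = q at *
  have hu0 : 0 < N ^ ((173:ℝ)/104) := Real.rpow_pos_of_pos hNp _
  have hv0 : 0 < q ^ (-(1:ℝ)/285) * N ^ ((476:ℝ)/285) :=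
    mul_pos (Real.rpow_pos_of_pos hqp _) (Real.rpow_pos_of_pos hNp _)
  have hu : ((N ^ ((173:ℝ)/104)) ^ 3) ^ 104 = N ^ 519 := by
    rw [← pow_mul, ← Real.rpow_natCast, ← Real.rpow_mul hNp.le, ← Real.rpow_natCast]
    norm_num
  have hv : ((q ^ (-(1:ℝ)/285) * N ^ ((476:ℝ)/285)) ^ 3) ^ 95 = q⁻¹ * N ^ 476 := by
    rw [← pow_mul, mul_pow, ← Real.rpow_natCast, ← Real.rpow_mul hqp.le, ← Real.rpow_natCast,
      ← Real.rpow_mul hNp.le, ← Real.rpow_natCast, ← Real.rpow_neg_one]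
    norm_num
  generalize N ^ ((173:ℝ)/104) = u at *
  generalize q ^ (-(1:ℝ)/285) * N ^ ((476:ℝ)/285) = v at *
  have hCpow : ∀ n : ℕ, n ≠ 0 → C0 ≤ C0 ^ n := fun n hn => le_self_pow₀ hC0 hn
  rcases hm with hm | hm
  · have h1 : r ^ 104 ≤ (C0 * u ^ 3) ^ 104 := by
      rw [mul_pow, hu]
      rw [div_pow, mul_div_assoc', le_div_iff₀ (by positivity)] at hm
      have h2 : N * r ^ 104 ≤ N * (C0 * N ^ 519) := by
        refine hm.trans (le_of_eq (by ring))
      have h3 := le_of_mul_le_mul_left h2 hNp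
      exact h3.trans (mul_le_mul_of_nonneg_right (hCpow 104 (by norm_num)) (by positivity))
    have h2 := (pow_le_pow_iff_left₀ hr0 (by positivity) (by norm_num)).1 h1
    have : 0 ≤ C0 * v ^ 3 := by positivity
    rw [mul_add]
    linarith only [h2, this]
  · have h1 : r ^ 95 ≤ (C0 * v ^ 3) ^ 95 := by
      rw [mul_pow, hv]
      rw [div_pow, mul_div_assoc', div_mul_eq_mul_div, le_div_iff₀ (by positivity)] at hm
      have h3 : r ^ 95 ≤ C0 * (q⁻¹ * N ^ 476) := by
        have : C0 * (q⁻¹ * N ^ 476) = (C0 * N ^ 476) / q := by field_simp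
        rw [this, le_div_iff₀ hqp]
        refine le_trans (le_of_eq (by ring)) (hm.trans (le_of_eq (by ring)))
      exact h3.trans (mul_le_mul_of_nonneg_right (hCpow 95 (by norm_num)) (by positivity))
    have h2 := (pow_le_pow_iff_left₀ hr0 (by positivity) (by norm_num)).1 h1
    have : 0 ≤ C0 * u ^ 3 := by positivity
    rw [mul_add]
    linarith only [h2, this]

lemma final_num (C0 b N u v S r β : ℝ) (hC0 : 1 ≤ C0) (hu : 0 ≤ u) (hv : 0 ≤ v)
    (hS0 : 0 ≤ S) (hβ0 : 0 ≤ β) (hβ : β ^ 3 = b ^ 4) (hS : S ^ 3 ≤ 4 * b ^ 4 * r)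
    (hr : r ≤ C0 * (u ^ 3 + v ^ 3)) (h1 : b * N ≤ u * β) (h2 : b ^ 2 ≤ u * β) :
    b * N + b ^ 2 + S ≤ (4 * C0 + 2) * ((u + v) * β) := by
  have h3 : S ^ 3 ≤ (4 * C0 * ((u + v) * β)) ^ 3 := by
    have e1 : 4 * b ^ 4 * r ≤ 4 * b ^ 4 * (C0 * (u ^ 3 + v ^ 3)) :=
      mul_le_mul_of_nonneg_left hr (by positivity)
    have e2 : u ^ 3 + v ^ 3 ≤ (u + v) ^ 3 := by
      have : 0 ≤ 3 * u * v * (u + v) := by positivity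
      nlinarith only [this]
    have e3 : 4 * b ^ 4 * (C0 * (u ^ 3 + v ^ 3)) ≤ 4 * b ^ 4 * (C0 * (u + v) ^ 3) :=
      mul_le_mul_of_nonneg_left (mul_le_mul_of_nonneg_left e2 (by linarith)) (by positivity)
    have e4 : (4 * C0 * ((u + v) * β)) ^ 3 = 64 * C0 ^ 3 * (u + v) ^ 3 * b ^ 4 := by
      rw [← hβ]; ring
    rw [e4]
    have e5 : C0 ≤ C0 ^ 3 := le_self_pow₀ hC0 (by norm_num)
    have e6 : 4 * C0 * ((u + v) ^ 3 * b ^ 4) ≤ 64 * C0 ^ 3 * ((u + v) ^ 3 * b ^ 4) :=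
      mul_le_mul_of_nonneg_right (by nlinarith only [e5, hC0]) (by positivity)
    linarith only [hS, e1, e3, e6]
  have h4 := (pow_le_pow_iff_left₀ hS0 (by positivity) (by norm_num)).1 h3
  have h5 : 0 ≤ v * β := by positivity
  nlinarith only [h1, h2, h4, h5]

lemma final_num2 (b N : ℝ) (hb : 1 ≤ b) (hbN : b ≤ N) :
    b * N ≤ N ^ ((173:ℝ)/104) * b ^ ((4:ℝ)/3) ∧ b ^ 2 ≤ N ^ ((173:ℝ)/104) * b ^ ((4:ℝ)/3) := by
  have hN : 1 ≤ N := hb.trans hbN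
  have e1 : b ≤ b ^ ((4:ℝ)/3) := by
    conv_lhs => rw [← Real.rpow_one b]
    exact Real.rpow_le_rpow_of_exponent_le hb (by norm_num)
  have e2 : N ≤ N ^ ((173:ℝ)/104) := by
    conv_lhs => rw [← Real.rpow_one N]
    exact Real.rpow_le_rpow_of_exponent_le hN (by norm_num)
  have h1 : b * N ≤ N ^ ((173:ℝ)/104) * b ^ ((4:ℝ)/3) := by
    rw [mul_comm b N]
    exact mul_le_mul e2 e1 (by linarith) (by linarith)
  refine ⟨h1, le_trans ?_ h1⟩
  nlinarith only [hb, hbN]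

theorem stmt8 : ∀ C : ℝ, 0 < C → ∃ C' : ℝ, 0 < C' ∧
    ∀ (F : Type) [Field F] [Fintype F] (q : ℕ), IsPrimePow q → Fintype.card F = q →
    ∀ A B : Finset F, 2 ≤ A.card → 2 ≤ B.card → (0:F) ∉ A → (0:F) ∉ B → (0:F) ∉ A + B →
    subfieldCond (A + B)⁻¹ C (((A + B).card : ℝ) ^ ((51:ℝ)/52)) →
    (addEnergy A⁻¹ B⁻¹ : ℝ) ≤
      C' * ((((A + B).card : ℝ) ^ ((173:ℝ)/104)
        + (q : ℝ) ^ (-(1:ℝ)/285) * (((A + B).card : ℝ)) ^ ((476:ℝ)/285)) *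
        (B.card : ℝ) ^ ((4:ℝ)/3)) := by
  intro C hC
  obtain ⟨C0, hC0, hbound⟩ := rsum_bound C hC
  refine ⟨4 * C0 + 2, by linarith, ?_⟩
  intro F _ _ q _ hq A B hA2 hB2 hA0 hB0 hAB hsub
  have hAne : A.Nonempty := Finset.card_pos.1 (by omega)
  have hBne : B.Nonempty := Finset.card_pos.1 (by omega)
  have hXc : ((A + B)⁻¹).card = (A + B).card := Finset.card_inv (A + B)
  have hr := hbound F (A + B)⁻¹ ((hAne.add hBne).inv) (by rw [hXc]; exact hsub)
  obtain ⟨S, hS0, hS3, hSs⟩ := reduce (A + B)⁻¹ B hB0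
  have hE := energy_le A B hA0 hB0 hAB
  have hE' : (addEnergy A⁻¹ B⁻¹ : ℝ) ≤ _ := (Nat.cast_le.2 hE).trans hSs
  rw [hXc, hq] at hr
  rw [hXc] at hE'
  refine hE'.trans ?_
  have hbN : (B.card : ℝ) ≤ (A + B).card := Nat.cast_le.2 (Finset.card_le_card_add_left hAne)
  have hb1 : (1:ℝ) ≤ B.card := by exact_mod_cast (by omega : 1 ≤ B.card)
  obtain ⟨h1, h2⟩ := final_num2 _ _ hb1 hbN
  have hβ : ((B.card : ℝ) ^ ((4:ℝ)/3)) ^ 3 = (B.card : ℝ) ^ 4 := by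
    rw [← Real.rpow_natCast, ← Real.rpow_mul (by linarith), ← Real.rpow_natCast]
    norm_num
  exact final_num C0 _ _ _ _ S _ _ hC0 (by positivity) (by positivity) hS0 (by positivity) hβ hS3
    hr h1 h2

end STP
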